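/- arXiv:2212.06753 — 3 statements merged into one kernel-verified Lean document; each statement's English description precedes it below -/
import Mathlib

section
/- Let p_1, …, p_n be distinct prime numbers and let (X, r) be an indecomposable multipermutation involutive non-degenerate set-theoretic solution of the Yang–Baxter equation of cardinality p_1⋯p_n. Consider the natural left brace structure on 𝒢(X,r) and let P_i be the Sylow p_i-subgroup of its additive group. Then there exists a permutation τ ∈ Sym_n such that: (a) the products P_{τ(1)}, P_{τ(1)}P_{τ(2)}, …, P_{τ(1)}P_{τ(2)}⋯P_{τ(n)} are ideals of the left brace 𝒢(X,r); (b) P_{τ(1)} ⊆ Soc(𝒢(X,r)); (c) for every 1 < i ≤ n, (P_{τ(1)}⋯P_{τ(i)})/(P_{τ(1)}⋯P_{τ(i−1)}) ⊆ Soc(𝒢(X,r)/(P_{τ(1)}⋯P_{τ(i−1)})); and (d) for every 1 ≤ i ≤ n, {g ∈ 𝒢(X,r) : g(P_{τ(1)}⋯P_{τ(i)}(x)) = P_{τ(1)}⋯P_{τ(i)}(x) for all x ∈ X} = P_{τ(1)}⋯P_{τ(i)}, where H(x) denotes the orbit {h(x) : h ∈ H}. -/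
open Equiv Pointwise

universe u v

/-- An involutive non-degenerate set-theoretic solution of the Yang–Baxter equation on `X`,
presented by its family of bijections `σ x` (`x ∈ X`), subject to the condition
`σ_x ∘ σ_{σ_x⁻¹(y)} = σ_y ∘ σ_{σ_y⁻¹(x)}`; the solution itself is recovered as
`r (x, y) = (σ x y, (σ (σ x y))⁻¹ x)`. -/
structure YBE (X : Type u) where
  σ : X → Equiv.Perm X
  ybe : ∀ x y : X, σ x * σ ((σ x)⁻¹ y) = σ y * σ ((σ y)⁻¹ x)

namespace YBE

variable {X : Type u} {Y : Type v}

/-- The permutation group `𝒢(X,r)` of a solution. -/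
def permGroup (S : YBE X) : Subgroup (Equiv.Perm X) :=
  Subgroup.closure (Set.range S.σ)

/-- `(X,r)` is indecomposable if `𝒢(X,r)` acts transitively on `X`. -/
def Indecomposable (S : YBE X) : Prop :=
  ∀ x y : X, ∃ g ∈ S.permGroup, g x = y

/-- Homomorphism of solutions. -/
def IsHom (S : YBE X) (T : YBE Y) (f : X → Y) : Prop :=
  ∀ x y : X, f (S.σ x y) = T.σ (f x) (f y)

/-- `T` is (a copy of) the retract `Ret(X,r)` of `S`: there is a surjective homomorphism
of solutions identifying points with equal `σ`'s, and only those. -/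
def IsRetract (S : YBE X) (T : YBE Y) : Prop :=
  ∃ f : X → Y, Function.Surjective f ∧ S.IsHom T f ∧
    ∀ x x' : X, f x = f x' ↔ S.σ x = S.σ x'

/-- `Retⁿ(X,r)` has cardinality one, i.e. the multipermutation level is at most `n`. -/
def MPLevelLE : ℕ → (X : Type u) → YBE X → Prop
  | 0, X, _ => Nonempty X ∧ Subsingleton X
  | n + 1, _, S => ∃ (Z : Type u) (T : YBE Z), S.IsRetract T ∧ MPLevelLE n Z T

/-- `(X,r)` is a multipermutation solution: `Retⁿ(X,r)` has cardinality one
for some positive integer `n`. -/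
def IsMultipermutation (S : YBE X) : Prop :=
  ∃ n : ℕ, 0 < n ∧ MPLevelLE n X S

/-- `m` is the multipermutation level of `(X,r)`: it is the least positive integer
with `|Retᵐ(X,r)| = 1`. -/
def MPLevelExact (S : YBE X) (m : ℕ) : Prop :=
  0 < m ∧ MPLevelLE m X S ∧ ∀ k : ℕ, 0 < k → MPLevelLE k X S → m ≤ k

/-- A simple solution: `|X| > 1` and every epimorphic image is either an isomorphic copy
or a singleton. -/
def IsSimple (S : YBE X) : Prop :=
  1 < Nat.card X ∧ ∀ (Z : Type u) (T : YBE Z) (f : X → Z),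
    S.IsHom T f → Function.Surjective f → (Function.Bijective f ∨ Nat.card Z = 1)

end YBE

/-- The orbit `H(x) = {t(x) : t ∈ H}` of `x ∈ X` under a subgroup `H` of a permutation
group `G ≤ Sym(X)`. -/
def orbIn {X : Type u} {G : Subgroup (Equiv.Perm X)} (H : Subgroup ↥G) (x : X) : Set X :=
  {y | ∃ t : ↥G, t ∈ H ∧ (t : Equiv.Perm X) x = y}

/-- The "orbit" `A(x) = {t(x) : t ∈ A}` of `x ∈ X` under a subset `A` of a permutation
group `G ≤ Sym(X)`. -/
def orbSet {X : Type u} {G : Subgroup (Equiv.Perm X)} (A : Set ↥G) (x : X) : Set X :=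
  {y | ∃ t ∈ A, ((t : Equiv.Perm X)) x = y}

/-- A left-brace structure on a group `G`: an abelian group operation `add` (whose neutral
element is `1`) satisfying the brace compatibility `a∘(b+c) + a = a∘b + a∘c`, where `∘` is the
given group operation of `G`.  In other words, this makes `G` a left brace whose
multiplicative group is `G`. -/
structure BraceOps (G : Type*) [Group G] where
  add : G → G → G
  neg : G → G
  add_assoc : ∀ a b c, add (add a b) c = add a (add b c)
  add_comm : ∀ a b, add a b = add b a
  zero_add : ∀ a, add 1 a = a
  neg_add_cancel : ∀ a, add (neg a) a = 1
  compat : ∀ a b c, add (a * add b c) a = add (a * b) (a * c)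

namespace BraceOps

variable {G : Type*} [Group G]

/-- The lambda map `λ_a(b) = -a + a∘b` of a left brace. -/
def lam (β : BraceOps G) (a b : G) : G :=
  β.add (β.neg a) (a * b)

/-- Natural multiples with respect to the additive structure of the brace. -/
def nsmul (β : BraceOps G) : ℕ → G → G
  | 0, _ => 1
  | n + 1, a => β.add a (β.nsmul n a)

/-- The socle `Soc(B) = {a : a∘b = a + b for all b}` of a left brace. -/
def socle (β : BraceOps G) : Set G :=
  {a | ∀ b : G, a * b = β.add a b}

/-- The Sylow `q`-subgroup (i.e. the `q`-primary component) of the additive group of a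
finite left brace. -/
def addSylow (β : BraceOps G) (q : ℕ) : Set G :=
  {a | ∃ k : ℕ, β.nsmul (q ^ k) a = 1}

/-- `A` is a subgroup of the additive group of the brace. -/
def IsAddSubgroup (β : BraceOps G) (A : Set G) : Prop :=
  1 ∈ A ∧ (∀ a ∈ A, ∀ b ∈ A, β.add a b ∈ A) ∧ ∀ a ∈ A, β.neg a ∈ A

/-- A left ideal of a left brace: an additive subgroup stable under all `λ_a`. -/
def IsLeftIdeal (β : BraceOps G) (L : Set G) : Prop :=
  β.IsAddSubgroup L ∧ ∀ a : G, ∀ b ∈ L, β.lam a b ∈ L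

/-- An ideal of a left brace: a normal subgroup of the multiplicative group stable
under all `λ_a`. -/
def IsIdeal (β : BraceOps G) (I : Set G) : Prop :=
  1 ∈ I ∧ (∀ a ∈ I, ∀ b ∈ I, a * b ∈ I) ∧ (∀ a ∈ I, a⁻¹ ∈ I) ∧
    (∀ g : G, ∀ a ∈ I, g * a * g⁻¹ ∈ I) ∧ ∀ g : G, ∀ a ∈ I, β.lam g a ∈ I

end BraceOps

namespace YBE

variable {X : Type u}

/-- `σ x` as an element of `𝒢(X,r)`. -/
def σg (S : YBE X) (x : X) : ↥S.permGroup :=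
  ⟨S.σ x, Subgroup.subset_closure (Set.mem_range_self x)⟩

/-- The natural left-brace structure on `𝒢(X,r)`: the unique left brace structure whose
multiplicative group is `𝒢(X,r)`, whose additive group is generated by `{σ_x : x ∈ X}`,
and whose lambda map satisfies `λ_g(σ_y) = σ_{g(y)}`. -/
structure IsNaturalBrace (S : YBE X) (β : BraceOps ↥S.permGroup) : Prop where
  lam_sigma : ∀ (g : ↥S.permGroup) (y : X),
    β.lam g (S.σg y) = S.σg ((g : Equiv.Perm X) y)
  add_gen : ∀ A : Set ↥S.permGroup, β.IsAddSubgroup A → (∀ x : X, S.σg x ∈ A) →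
    ∀ g : ↥S.permGroup, g ∈ A

/-- The product `P_{τ(1)} P_{τ(2)} ⋯ P_{τ(i)}` of Sylow subgroups of the additive group of
the left brace `𝒢(X,r)`, taken inside the multiplicative group. -/
def sylProdTake (S : YBE X) (β : BraceOps ↥S.permGroup) {n : ℕ} (p : Fin n → ℕ)
    (τ : Equiv.Perm (Fin n)) (i : ℕ) : Set ↥S.permGroup :=
  ((List.ofFn fun j : Fin n => β.addSylow (p (τ j))).take i).prod

/-- The product `P_{i+1} P_{i+2} ⋯ P_n` of Sylow subgroups of the additive group of the
left brace `𝒢(X,r)`, taken inside the multiplicative group. -/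
def sylProdDrop (S : YBE X) (β : BraceOps ↥S.permGroup) {n : ℕ} (p : Fin n → ℕ)
    (i : ℕ) : Set ↥S.permGroup :=
  ((List.ofFn fun j : Fin n => β.addSylow (p j)).drop i).prod

end YBE

/-- The holomorph `ℤ/(q) ⋊ Aut(ℤ/(q))` of the cyclic group of order `q`. -/
abbrev Hol (q : ℕ) :=
  SemidirectProduct (Multiplicative (ZMod q)) (MulAut (Multiplicative (ZMod q)))
    (MonoidHom.id (MulAut (Multiplicative (ZMod q))))

/-- Kronecker delta `δ_{u,w} ∈ ℤ/(q)`. -/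
noncomputable def kdelta (q : ℕ) {α : Type v} (u w : α) : ZMod q :=
  letI := Classical.propDecidable (u = w)
  if u = w then 1 else 0

/-- The map `σ'_{(a,x)}(b,y) = (b + δ_{x,σ_x(y)}, σ_x(y))` on `ℤ/(q) × Y`. -/
noncomputable def extMap {Y : Type v} (T : YBE Y) (q : ℕ) (a b : ZMod q × Y) :
    ZMod q × Y :=
  (b.1 + kdelta q a.2 (T.σ a.2 b.2), T.σ a.2 b.2)

namespace BraceOps

variable {G : Type*} [Group G]

/-- The additive group of a left brace. -/
abbrev toAddCommGroup (β : BraceOps G) : AddCommGroup G where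
  add := β.add
  zero := 1
  neg := β.neg
  add_assoc := β.add_assoc
  add_comm := β.add_comm
  zero_add := β.zero_add
  add_zero a := (β.add_comm a 1).trans (β.zero_add a)
  neg_add_cancel := β.neg_add_cancel
  nsmul := β.nsmul
  nsmul_zero _ := rfl
  nsmul_succ n a := β.add_comm a (β.nsmul n a)
  zsmul := @zsmulRec G ⟨1⟩ ⟨β.add⟩ ⟨β.neg⟩ β.nsmul
  zsmul_succ' n a := β.add_comm a (β.nsmul n a)

theorem lam_add (β : BraceOps G) (a b c : G) :
    β.lam a (β.add b c) = β.add (β.lam a b) (β.lam a c) := by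
  let _ := β.toAddCommGroup
  have h : a * (b + c) + a = a * b + a * c := β.compat a b c
  change -a + a * (b + c) = (-a + a * b) + (-a + a * c)
  rw [eq_sub_of_add_eq h]
  abel

theorem lam_one_right (β : BraceOps G) (a : G) : β.lam a 1 = 1 := by
  change β.add (β.neg a) (a * 1) = 1
  rw [mul_one, β.neg_add_cancel]

theorem lam_neg (β : BraceOps G) (a b : G) : β.lam a (β.neg b) = β.neg (β.lam a b) := by
  let _ := β.toAddCommGroup
  have h : β.lam a (-b) + β.lam a b = 0 := by
    refine (β.lam_add a (β.neg b) b).symm.trans ?_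
    rw [β.neg_add_cancel]
    exact β.lam_one_right a
  exact eq_neg_of_add_eq_zero_left h

theorem mem_socle_iff (β : BraceOps G) {a : G} : a ∈ β.socle ↔ ∀ b, β.lam a b = b := by
  let _ := β.toAddCommGroup
  refine forall_congr' fun b => ?_
  change a * b = a + b ↔ -a + a * b = b
  rw [neg_add_eq_iff_eq_add]

theorem mul_comm_of_mem_socle (β : BraceOps G) {a b : G} (ha : a ∈ β.socle)
    (hb : b ∈ β.socle) : a * b = b * a := by
  rw [ha b, hb a, β.add_comm]

theorem nsmul_eq_pow_of_mem_socle (β : BraceOps G) {a : G} (ha : a ∈ β.socle) (k : ℕ) :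
    β.nsmul k a = a ^ k := by
  induction k with
  | zero => exact (pow_zero a).symm
  | succ k ih => rw [pow_succ', ← ih, ha]; rfl

/-- A map respecting both operations of a left brace. -/
structure IsBraceHom {H : Type*} [Group H] (β : BraceOps G) (γ : BraceOps H) (π : G →* H) :
    Prop where
  map_add : ∀ a b, π (β.add a b) = γ.add (π a) (π b)

namespace IsBraceHom

variable {H : Type*} [Group H] {β : BraceOps G} {γ : BraceOps H} {π : G →* H}

theorem map_neg (h : IsBraceHom β γ π) (a : G) : π (β.neg a) = γ.neg (π a) := by
  let _ := γ.toAddCommGroup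
  have : π (β.neg a) + π a = 0 := by
    refine (h.map_add _ _).symm.trans ?_
    rw [β.neg_add_cancel, map_one]
    rfl
  exact eq_neg_of_add_eq_zero_left this

theorem map_lam (h : IsBraceHom β γ π) (a b : G) : π (β.lam a b) = γ.lam (π a) (π b) := by
  rw [lam, lam, h.map_add, h.map_neg, map_mul]

theorem map_nsmul (h : IsBraceHom β γ π) (k : ℕ) (a : G) :
    π (β.nsmul k a) = γ.nsmul k (π a) := by
  induction k with
  | zero => exact map_one π
  | succ k ih => exact (h.map_add _ _).trans (congrArg _ ih)

theorem isIdeal_preimage (h : IsBraceHom β γ π) {I : Set H} (hI : γ.IsIdeal I) :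
    β.IsIdeal (π ⁻¹' I) := by
  obtain ⟨h1, hmul, hinv, hconj, hlam⟩ := hI
  refine ⟨?_, fun a ha b hb => ?_, fun a ha => ?_, fun g a ha => ?_, fun g a ha => ?_⟩
  · simpa using h1
  · simpa using hmul _ ha _ hb
  · simpa using hinv _ ha
  · simpa using hconj (π g) _ ha
  · simpa [h.map_lam] using hlam (π g) _ ha

/-- The primary components of the additive group of a finite left brace map onto those of
a quotient. -/
theorem image_addSylow [Finite G] (h : IsBraceHom β γ π) (hπ : Function.Surjective π) {q : ℕ}
    (hq : q.Prime) : π '' β.addSylow q = γ.addSylow q := by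
  let _ := β.toAddCommGroup
  let _ := γ.toAddCommGroup
  ext y
  constructor
  · rintro ⟨a, ⟨k, hk⟩, rfl⟩
    exact ⟨k, by rw [← h.map_nsmul, hk, map_one]⟩
  · rintro ⟨k, hk⟩
    obtain ⟨g, rfl⟩ := hπ y
    obtain ⟨e, m, hm, hcard⟩ := Nat.exists_eq_pow_mul_and_not_dvd
      (Nat.card_pos (α := G)).ne' q hq.ne_one
    have hcop : m.Coprime (q ^ k) := ((hq.coprime_iff_not_dvd.2 hm).pow_left k).symm
    obtain ⟨u, hu⟩ : ∃ u : ℕ, m * u ≡ 1 [MOD q ^ k] := by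
      have := Nat.exists_mul_mod_eq_one_of_coprime hcop
      obtain hk1 | hk1 := (Nat.one_le_pow k q hq.pos).eq_or_lt
      · exact ⟨0, by rw [← hk1]; exact Nat.modEq_one⟩
      · obtain ⟨u, -, hu⟩ := this hk1
        exact ⟨u, hu.trans (Nat.mod_eq_of_lt hk1).symm⟩
    refine ⟨β.nsmul (m * u) g, ⟨e, ?_⟩, ?_⟩
    · change (q ^ e) • (m * u) • g = 0
      rw [← mul_nsmul', ← mul_assoc, ← hcard, mul_nsmul', card_nsmul_eq_zero']
    · rw [h.map_nsmul]
      have hd : addOrderOf (π g) ∣ q ^ k := addOrderOf_dvd_of_nsmul_eq_zero hk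
      have h2 : (m * u) • π g = 1 • π g := nsmul_eq_nsmul_iff_modEq.2 (hu.of_dvd hd)
      exact h2.trans (one_nsmul _)

end IsBraceHom

theorem exists_quotient {H : Type*} [Group H] (β : BraceOps G) (π : G →* H)
    (hπ : Function.Surjective π) (hker : ∀ a, π a = 1 → a ∈ β.socle) :
    ∃ γ : BraceOps H, IsBraceHom β γ π := by
  let _ := β.toAddCommGroup
  have key : ∀ a a' b b', π a = π a' → π b = π b' → π (a + b) = π (a' + b') := by
    intro a a' b b' ha hb
    have hk : π (a' * a⁻¹) = 1 := by simp [ha]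
    have hl : π (b' * b⁻¹) = 1 := by simp [hb]
    have hkl : π (a' * a⁻¹ * (b' * b⁻¹)) = 1 := by rw [map_mul, hk, hl, mul_one]
    have e1 : a' = a' * a⁻¹ + a := by
      have : a' * a⁻¹ * a = a' * a⁻¹ + a := hker _ hk a
      simpa using this
    have e2 : b' = b' * b⁻¹ + b := by
      have : b' * b⁻¹ * b = b' * b⁻¹ + b := hker _ hl b
      simpa using this
    have e3 : a' * a⁻¹ * (b' * b⁻¹) = a' * a⁻¹ + b' * b⁻¹ := hker _ hk _
    have e4 : a' * a⁻¹ * (b' * b⁻¹) * (a + b) = a' * a⁻¹ * (b' * b⁻¹) + (a + b) :=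
      hker _ hkl _
    have e5 : a' + b' = a' * a⁻¹ * (b' * b⁻¹) * (a + b) := by
      rw [e4, e3]
      nth_rewrite 1 [e1, e2]
      abel
    rw [e5, map_mul, hkl, one_mul]
  have hs := Function.surjInv_eq hπ
  have hadd : ∀ a b, π (β.add (Function.surjInv hπ (π a)) (Function.surjInv hπ (π b))) =
      π (β.add a b) := fun a b => key _ _ _ _ (hs _) (hs _)
  refine ⟨{ add := fun x y => π (β.add (Function.surjInv hπ x) (Function.surjInv hπ y))
            neg := fun x => π (β.neg (Function.surjInv hπ x))
            add_assoc := ?_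
            add_comm := fun x y => by rw [β.add_comm]
            zero_add := ?_
            neg_add_cancel := ?_
            compat := ?_ }, ⟨fun a b => (hadd a b).symm⟩⟩
  · refine hπ.forall.2 fun a => hπ.forall.2 fun b => hπ.forall.2 fun c => ?_
    simp only [hadd, β.add_assoc]
  · refine hπ.forall.2 fun a => ?_
    rw [← map_one π, hadd, β.zero_add]
  · intro x
    nth_rewrite 2 [← hs x]
    rw [hadd, β.neg_add_cancel, map_one]
  · refine hπ.forall.2 fun a => hπ.forall.2 fun b => hπ.forall.2 fun c => ?_
    rw [hadd, ← map_mul, ← map_mul, ← map_mul, hadd, hadd, β.compat]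

end BraceOps

/-- The `p`-primary part of a commutative subgroup. -/
def primaryPart {G : Type*} [Group G] (N : Subgroup G) (hN : ∀ a ∈ N, ∀ b ∈ N, a * b = b * a)
    (p : ℕ) : Subgroup G where
  carrier := {a | a ∈ N ∧ ∃ k : ℕ, a ^ p ^ k = 1}
  one_mem' := ⟨N.one_mem, 0, one_pow _⟩
  mul_mem' := by
    rintro a b ⟨ha, k, hk⟩ ⟨hb, l, hl⟩
    refine ⟨N.mul_mem ha hb, k + l, ?_⟩
    rw [(show Commute a b from hN a ha b hb).mul_pow, pow_add, pow_mul, hk, one_pow,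
      mul_comm, pow_mul, hl, one_pow, one_mul]
  inv_mem' := by
    rintro a ⟨ha, k, hk⟩
    exact ⟨N.inv_mem ha, k, by rw [inv_pow, hk, inv_one]⟩

theorem primaryPart_normal {G : Type*} [Group G] (N : Subgroup G) [hn : N.Normal]
    (hN : ∀ a ∈ N, ∀ b ∈ N, a * b = b * a) (p : ℕ) : (primaryPart N hN p).Normal := by
  refine ⟨?_⟩
  rintro a ⟨ha, k, hk⟩ g
  exact ⟨hn.conj_mem a ha g, k, by rw [conj_pow, hk, mul_one, mul_inv_cancel]⟩

theorem primaryPart_isPGroup {G : Type*} [Group G] (N : Subgroup G)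
    (hN : ∀ a ∈ N, ∀ b ∈ N, a * b = b * a) (p : ℕ) : IsPGroup p (primaryPart N hN p) := by
  rintro ⟨a, ha, k, hk⟩
  exact ⟨k, Subtype.ext hk⟩

theorem primaryPart_ne_bot {G : Type*} [Group G] [Finite G] (N : Subgroup G)
    (hN : ∀ a ∈ N, ∀ b ∈ N, a * b = b * a) {p : ℕ} (hp : p.Prime) (hdvd : p ∣ Nat.card N) :
    primaryPart N hN p ≠ ⊥ := by
  have : Fact p.Prime := ⟨hp⟩
  obtain ⟨a, ha⟩ := exists_prime_orderOf_dvd_card' p hdvd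
  intro hbot
  have h : (a : G) ∈ primaryPart N hN p := by
    refine ⟨a.2, 1, ?_⟩
    rw [pow_one, ← ha, ← Subgroup.orderOf_coe, pow_orderOf_eq_one]
  rw [hbot, Subgroup.mem_bot, OneMemClass.coe_eq_one] at h
  rw [h, orderOf_one] at ha
  exact hp.one_lt.ne ha

/-- All fibres of an equivariant map out of a transitive permutation group are equinumerous. -/
theorem card_eq_card_mul_card_fiber {X Y : Type*} [Finite X] (f : X → Y)
    (hf : Function.Surjective f)
    (htrans : ∀ x y : X, ∃ e : Equiv.Perm X, e x = y ∧ ∀ a b, f a = f b ↔ f (e a) = f (e b))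
    (x : X) : Nat.card X = Nat.card Y * Nat.card {a // f a = f x} := by
  have : Finite Y := Finite.of_surjective f hf
  have := Fintype.ofFinite Y
  have hfib : ∀ y, Nat.card {a // f a = y} = Nat.card {a // f a = f x} := by
    refine hf.forall.2 fun z => ?_
    obtain ⟨e, rfl, he⟩ := htrans x z
    exact (Nat.card_congr (e.subtypeEquiv fun a => he a x)).symm
  rw [← Nat.card_congr (Equiv.sigmaFiberEquiv f), Nat.card_sigma,
    Finset.sum_congr rfl fun y _ => hfib y, Finset.sum_const, smul_eq_mul, Finset.card_univ,
    Nat.card_eq_fintype_card (α := Y)]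

theorem exists_card_eq_mul_prime_pow {X Y : Type*} [Finite X] {G : Subgroup (Equiv.Perm X)}
    (htrans : ∀ x y : X, ∃ g ∈ G, g x = y) {p : ℕ} [Fact p.Prime] (P : Subgroup G)
    [hPn : P.Normal] (hP : IsPGroup p P) (hne : P ≠ ⊥) (f : X → Y)
    (hf : Function.Surjective f)
    (hfib : ∀ x x', f x = f x' ↔ ∃ k ∈ P, (k : Equiv.Perm X) x = x') :
    ∃ m : ℕ, Nat.card X = Nat.card Y * p ^ (m + 1) := by
  obtain ⟨⟨k, hkP⟩, hk⟩ := Subgroup.ne_bot_iff_exists_ne_one.1 hne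
  obtain ⟨x, hx⟩ : ∃ x, (k : Equiv.Perm X) x ≠ x := by
    by_contra! h
    exact hk (Subtype.ext (Subtype.ext (Equiv.ext h)))
  have hcard := card_eq_card_mul_card_fiber f hf (fun a b => by
    obtain ⟨g, hg, hgab⟩ := htrans a b
    refine ⟨g, hgab, fun c d => ?_⟩
    rw [hfib, hfib]
    constructor
    · rintro ⟨t, ht, rfl⟩
      exact ⟨⟨g, hg⟩ * t * ⟨g, hg⟩⁻¹, hPn.conj_mem t ht _, by simp⟩
    · rintro ⟨t, ht, h⟩
      refine ⟨⟨g, hg⟩⁻¹ * t * ⟨g, hg⟩, by simpa using hPn.conj_mem t ht ⟨g, hg⟩⁻¹, ?_⟩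
      simp [h]) x
  have horb : Nat.card {a // f a = f x} = Nat.card (MulAction.orbit P x) := by
    refine Nat.card_congr (Equiv.subtypeEquivRight fun a => ?_)
    rw [eq_comm, hfib]
    constructor
    · rintro ⟨t, ht, h⟩
      exact ⟨⟨t, ht⟩, h⟩
    · rintro ⟨t, h⟩
      exact ⟨t, t.2, h⟩
  obtain ⟨m, hm⟩ := hP.card_orbit x
  obtain _ | m := m
  · rw [pow_zero, ← horb] at hm
    obtain ⟨h, -⟩ := Nat.card_eq_one_iff_unique.1 hm
    have := h.elim ⟨_, ((hfib x _).2 ⟨k, hkP, rfl⟩).symm⟩ ⟨x, rfl⟩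
    exact absurd (congrArg Subtype.val this) hx
  · exact ⟨m, by rw [hcard, horb, hm]⟩

namespace YBE

variable {X Y : Type u}

/-- A surjective homomorphism of solutions that identifies only points with equal `σ`'s. -/
structure IsCover (S : YBE X) (T : YBE Y) (f : X → Y) : Prop where
  surj : Function.Surjective f
  hom : S.IsHom T f
  σ_eq : ∀ x x', f x = f x' → S.σ x = S.σ x'

theorem exists_permGroup_hom {S : YBE X} {T : YBE Y} {f : X → Y}
    (hf : Function.Surjective f) (hom : S.IsHom T f) :
    ∃ π : S.permGroup →* T.permGroup, Function.Surjective π ∧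
      (∀ (g : S.permGroup) x, f ((g : Equiv.Perm X) x) = (π g : Equiv.Perm Y) (f x)) ∧
      ∀ x, π (S.σg x) = T.σg (f x) := by
  have hex : ∀ g ∈ S.permGroup, ∃ h ∈ T.permGroup, ∀ x, f (g x) = h (f x) := by
    intro g hg
    refine Subgroup.closure_induction ?_ ?_ ?_ ?_ hg
    · rintro _ ⟨x, rfl⟩
      exact ⟨T.σ (f x), (T.σg (f x)).2, hom x⟩
    · exact ⟨1, one_mem _, fun _ => rfl⟩
    · rintro a b - - ⟨c, hc, hac⟩ ⟨d, hd, hbd⟩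
      exact ⟨c * d, mul_mem hc hd, fun x => by simp [hac, hbd]⟩
    · rintro a - ⟨c, hc, hac⟩
      exact ⟨c⁻¹, inv_mem hc, fun x => by rw [Equiv.Perm.eq_inv_iff_eq, ← hac]; simp⟩
  have huniq : ∀ h h' : T.permGroup,
      (∀ x, (h : Equiv.Perm Y) (f x) = (h' : Equiv.Perm Y) (f x)) → h = h' :=
    fun h h' H => Subtype.ext (Equiv.ext (hf.forall.2 H))
  choose φ hφ hφf using hex
  let π : S.permGroup →* T.permGroup := MonoidHom.mk' (fun g => ⟨φ g g.2, hφ g g.2⟩)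
    fun a b => huniq _ _ fun x => by
      change φ _ _ (f x) = φ a a.2 (φ b b.2 (f x))
      rw [← hφf, ← hφf, ← hφf]
      rfl
  have hπ : ∀ x, π (S.σg x) = T.σg (f x) := fun x => huniq _ _ fun y =>
    (hφf _ (S.σg x).2 y).symm.trans (hom x y)
  refine ⟨π, ?_, fun g x => hφf g g.2 x, hπ⟩
  rintro ⟨h, hh⟩
  suffices h ∈ π.range.map T.permGroup.subtype by
    obtain ⟨_, ⟨g, rfl⟩, hg⟩ := this
    exact ⟨g, Subtype.ext hg⟩
  refine (Subgroup.closure_le _).2 ?_ hh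
  rintro _ ⟨y, rfl⟩
  obtain ⟨x, rfl⟩ := hf y
  exact ⟨_, ⟨S.σg x, rfl⟩, by rw [hπ]; rfl⟩

theorem Indecomposable.of_surjective {S : YBE X} {T : YBE Y} {f : X → Y}
    (hind : S.Indecomposable) (hf : Function.Surjective f) (hom : S.IsHom T f) :
    T.Indecomposable := by
  obtain ⟨π, -, hπf, -⟩ := exists_permGroup_hom hf hom
  refine hf.forall.2 fun x => hf.forall.2 fun y => ?_
  obtain ⟨g, hg, rfl⟩ := hind x y
  exact ⟨π ⟨g, hg⟩, (π ⟨g, hg⟩).2, (hπf ⟨g, hg⟩ x).symm⟩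

theorem IsNaturalBrace.mem_socle {S : YBE X} {β : BraceOps S.permGroup}
    (hβ : S.IsNaturalBrace β) {g : S.permGroup}
    (hg : ∀ x, S.σ ((g : Equiv.Perm X) x) = S.σ x) : g ∈ β.socle := by
  refine β.mem_socle_iff.2 (hβ.add_gen {b | β.lam g b = b} ⟨β.lam_one_right g, ?_, ?_⟩ ?_)
  · intro a ha b hb
    exact (β.lam_add g a b).trans (congrArg₂ _ ha hb)
  · intro a ha
    exact (β.lam_neg g a).trans (congrArg _ ha)
  · intro x
    exact (hβ.lam_sigma g x).trans (Subtype.ext (hg x))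

theorem IsNaturalBrace.σ_apply_of_mem_socle {S : YBE X} {β : BraceOps S.permGroup}
    (hβ : S.IsNaturalBrace β) {g : S.permGroup} (hg : g ∈ β.socle) (x : X) :
    S.σ ((g : Equiv.Perm X) x) = S.σ x :=
  congrArg Subtype.val ((hβ.lam_sigma g x).symm.trans (β.mem_socle_iff.1 hg _))

theorem IsCover.exists_quotient {S : YBE X} {T : YBE Y} {f : X → Y} (hf : IsCover S T f)
    {β : BraceOps S.permGroup} (hβ : S.IsNaturalBrace β) :
    ∃ (π : S.permGroup →* T.permGroup) (γ : BraceOps T.permGroup),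
      Function.Surjective π ∧
      (∀ (g : S.permGroup) x, f ((g : Equiv.Perm X) x) = (π g : Equiv.Perm Y) (f x)) ∧
      (∀ g, π g = 1 → g ∈ β.socle) ∧ BraceOps.IsBraceHom β γ π ∧ T.IsNaturalBrace γ := by
  obtain ⟨π, hπ, hπf, hπσ⟩ := exists_permGroup_hom hf.surj hf.hom
  have hker : ∀ g, π g = 1 → g ∈ β.socle := fun g hg =>
    hβ.mem_socle fun x => hf.σ_eq _ _ (by rw [hπf, hg]; rfl)
  obtain ⟨γ, hγ⟩ := β.exists_quotient π hπ hker
  refine ⟨π, γ, hπ, hπf, hker, hγ, ?_, ?_⟩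
  · refine hπ.forall.2 fun g => hf.surj.forall.2 fun x => ?_
    rw [← hπσ, ← hγ.map_lam, hβ.lam_sigma, hπσ, hπf]
  · rintro A ⟨h1, hadd, hneg⟩ hA
    refine hπ.forall.2 (hβ.add_gen (π ⁻¹' A) ⟨?_, ?_, ?_⟩ fun x => ?_)
    · simpa using h1
    · intro a ha b hb
      simpa [hγ.map_add] using hadd _ ha _ hb
    · intro a ha
      simpa [hγ.map_neg] using hneg _ ha
    · simpa [hπσ] using hA (f x)

theorem map_eq_one_iff_forall_apply {S : YBE X} {T : YBE Y} {f : X → Y} (hf : Function.Surjective f)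
    {π : S.permGroup →* T.permGroup}
    (hπf : ∀ (g : S.permGroup) x, f ((g : Equiv.Perm X) x) = (π g : Equiv.Perm Y) (f x))
    {g : S.permGroup} : π g = 1 ↔ ∀ x, f ((g : Equiv.Perm X) x) = f x := by
  refine ⟨fun h x => by rw [hπf, h]; rfl, fun h => Subtype.ext (Equiv.ext (hf.forall.2 ?_))⟩
  intro x
  rw [← hπf, h]
  rfl

/-- The solution induced on the quotient by an equivalence relation that is preserved by all
`σ x` and identifies only points with equal `σ`'s. -/
def quotient (S : YBE X) (r : Setoid X) (hσ : ∀ x y, r x y → S.σ x = S.σ y)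
    (hr : ∀ z x y, r x y ↔ r (S.σ z x) (S.σ z y)) : YBE (Quotient r) where
  σ := Quotient.lift (fun z => Quotient.congr (S.σ z) (hr z)) fun x y h => by
    apply Equiv.ext
    rintro ⟨a⟩
    exact congrArg (fun e : Equiv.Perm X => Quotient.mk r (e a)) (hσ x y h)
  ybe := by
    rintro ⟨x⟩ ⟨y⟩
    apply Equiv.ext
    rintro ⟨a⟩
    exact congrArg (fun e : Equiv.Perm X => Quotient.mk r (e a)) (S.ybe x y)

theorem quotient_isCover (S : YBE X) (r : Setoid X) (hσ : ∀ x y, r x y → S.σ x = S.σ y)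
    (hr : ∀ z x y, r x y ↔ r (S.σ z x) (S.σ z y)) :
    IsCover S (S.quotient r hσ hr) (Quotient.mk r) where
  surj := Quotient.mk_surjective
  hom _ _ := rfl
  σ_eq x x' h := hσ x x' (Quotient.exact h)

/-- Solutions that reach a point through a finite chain of covers. -/
inductive HasTower : {X : Type u} → YBE X → Prop
  | point {X : Type u} (S : YBE X) (h : Subsingleton X) : HasTower S
  | cover {X Y : Type u} (S : YBE X) (T : YBE Y) (f : X → Y) (hf : IsCover S T f)
      (hT : HasTower T) : HasTower S

theorem MPLevelLE.hasTower : ∀ {m : ℕ} {X : Type u} {S : YBE X}, MPLevelLE m X S → HasTower S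
  | 0, _, _, h => .point _ h.2
  | _ + 1, _, _, ⟨_, T, ⟨f, hf, hom, hσ⟩, hT⟩ =>
    .cover _ T f ⟨hf, hom, fun x x' => (hσ x x').1⟩ hT.hasTower

theorem HasTower.exists_not_injective {S : YBE X} (h : HasTower S) (hX : Nontrivial X) :
    ∃ (Y : Type u) (T : YBE Y) (f : X → Y), IsCover S T f ∧ ¬ Function.Injective f ∧
      HasTower T := by
  induction h with
  | point S h => exact absurd h (not_subsingleton _)
  | cover S T f hf hT ih =>
    by_cases hinj : Function.Injective f
    · obtain ⟨Z, U, g, hg, hgi, hU⟩ := ih hinj.nontrivial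
      refine ⟨Z, U, g ∘ f, ⟨hg.surj.comp hf.surj, fun x y => ?_, fun x x' h => ?_⟩, ?_, hU⟩
      · exact (congrArg g (hf.hom x y)).trans (hg.hom _ _)
      · ext y
        apply hinj
        rw [hf.hom, hf.hom, hg.σ_eq _ _ h]
      · intro hi
        apply hgi
        intro a b hab
        obtain ⟨a, rfl⟩ := hf.surj a
        obtain ⟨b, rfl⟩ := hf.surj b
        exact congrArg f (hi hab)
    · exact ⟨_, T, f, hf, hinj, hT⟩

theorem card_eq_card_mul_card_fiber_of_hom {S : YBE X} {T : YBE Y} [Finite X] {f : X → Y}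
    (hind : S.Indecomposable) (hf : Function.Surjective f) (hom : S.IsHom T f) (x : X) :
    Nat.card X = Nat.card Y * Nat.card {a // f a = f x} := by
  obtain ⟨π, -, hπf, -⟩ := exists_permGroup_hom hf hom
  refine card_eq_card_mul_card_fiber f hf (fun a b => ?_) x
  obtain ⟨g, hg, hgab⟩ := hind a b
  refine ⟨g, hgab, fun c d => ?_⟩
  rw [hπf ⟨g, hg⟩, hπf ⟨g, hg⟩, (Equiv.injective _).eq_iff]

theorem Indecomposable.dvd_card_of_dvd_card_normal {S : YBE X} [Finite X]
    (hind : S.Indecomposable) (N : Subgroup S.permGroup) [N.Normal]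
    (hN : ∀ a ∈ N, ∀ b ∈ N, a * b = b * a) {q : ℕ} (hq : q.Prime) (hdvd : q ∣ Nat.card N) :
    q ∣ Nat.card X := by
  have : Fact q.Prime := ⟨hq⟩
  have := primaryPart_normal N hN q
  obtain ⟨m, hm⟩ := exists_card_eq_mul_prime_pow hind _ (primaryPart_isPGroup N hN q)
    (primaryPart_ne_bot N hN hq hdvd)
    (Quotient.mk (MulAction.orbitRel (primaryPart N hN q) X)) Quotient.mk_surjective
    (fun x x' => by
      rw [Quotient.eq, MulAction.orbitRel_apply, MulAction.mem_orbit_symm]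
      constructor
      · rintro ⟨t, h⟩
        exact ⟨t, t.2, h⟩
      · rintro ⟨t, ht, h⟩
        exact ⟨⟨t, ht⟩, h⟩)
  exact hm ▸ (dvd_pow_self q m.succ_ne_zero).mul_left _

/-- The primes dividing the order of the permutation group of an indecomposable
multipermutation solution divide the cardinality of the solution. -/
theorem HasTower.dvd_card {S : YBE X} (h : HasTower S) [hfin : Finite X]
    (hind : S.Indecomposable) {β : BraceOps S.permGroup} (hβ : S.IsNaturalBrace β) {q : ℕ}
    (hq : q.Prime) (hdvd : q ∣ Nat.card S.permGroup) : q ∣ Nat.card X := by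
  induction h generalizing hfin with
  | point S h =>
    rw [Nat.card_of_subsingleton (1 : S.permGroup)] at hdvd
    exact absurd hdvd hq.not_dvd_one
  | @cover X Y S T f hf hT ih =>
    obtain ⟨π, γ, hπ, hπf, hker, hγ, hγn⟩ := hf.exists_quotient hβ
    have hY : Finite Y := Finite.of_surjective f hf.surj
    rw [← π.ker.index_mul_card, Subgroup.index_ker, MonoidHom.range_eq_top.2 hπ,
      Subgroup.card_top] at hdvd
    obtain h | h := hq.dvd_mul.1 hdvd
    · have hYX := ih (hind.of_surjective hf.surj hf.hom) hγn h
      obtain hX | ⟨⟨x⟩⟩ := isEmpty_or_nonempty X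
      · simp
      · rw [card_eq_card_mul_card_fiber_of_hom hind hf.surj hf.hom x]
        exact hYX.mul_right _
    · exact hind.dvd_card_of_dvd_card_normal π.ker
        (fun a ha b hb => β.mul_comm_of_mem_socle (hker a ha) (hker b hb)) hq h

/-- The setoid of orbits of a subgroup of a permutation group. -/
def orbitSetoid {G : Subgroup (Equiv.Perm X)} (P : Subgroup G) : Setoid X where
  r x y := ∃ k ∈ P, (k : Equiv.Perm X) x = y
  iseqv := by
    refine ⟨fun x => ⟨1, P.one_mem, rfl⟩, ?_, ?_⟩
    · rintro x _ ⟨k, hk, rfl⟩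
      exact ⟨k⁻¹, P.inv_mem hk, by simp⟩
    · rintro x _ _ ⟨k, hk, rfl⟩ ⟨l, hl, rfl⟩
      exact ⟨l * k, P.mul_mem hl hk, rfl⟩

theorem orbitSetoid_apply_iff {G : Subgroup (Equiv.Perm X)} (P : Subgroup G) [hP : P.Normal]
    (g : G) (x y : X) : orbitSetoid P x y ↔
      orbitSetoid P ((g : Equiv.Perm X) x) ((g : Equiv.Perm X) y) := by
  constructor
  · rintro ⟨k, hk, rfl⟩
    exact ⟨g * k * g⁻¹, hP.conj_mem k hk g, by simp⟩
  · rintro ⟨k, hk, h⟩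
    refine ⟨g⁻¹ * k * g, by simpa using hP.conj_mem k hk g⁻¹, ?_⟩
    simp [h]

theorem addSylow_eq_primaryPart {G H : Type*} [Group G] [Group H] [Finite G] {β : BraceOps G}
    {γ : BraceOps H} {π : G →* H} (hγ : BraceOps.IsBraceHom β γ π)
    (hker : ∀ g, π g = 1 → g ∈ β.socle)
    (hcomm : ∀ a ∈ π.ker, ∀ b ∈ π.ker, a * b = b * a) {p : ℕ} (hp : p.Prime)
    (hdvd : ¬ p ∣ Nat.card H) : β.addSylow p = primaryPart π.ker hcomm p := by
  let _ := γ.toAddCommGroup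
  ext g
  constructor
  · rintro ⟨k, hk⟩
    have h1 : (p ^ k) • π g = 0 := by
      refine (hγ.map_nsmul _ _).symm.trans ?_
      rw [hk, map_one]
      rfl
    have h2 : (Nat.card H) • π g = 0 := card_nsmul_eq_zero'
    have hg : π g = 1 := by
      have := Nat.dvd_gcd (addOrderOf_dvd_of_nsmul_eq_zero h1)
        (addOrderOf_dvd_of_nsmul_eq_zero h2)
      rw [((hp.coprime_iff_not_dvd.2 hdvd).pow_left k).gcd_eq_one, Nat.dvd_one,
        AddMonoid.addOrderOf_eq_one_iff] at this
      exact this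
    exact ⟨hg, k, by rw [← β.nsmul_eq_pow_of_mem_socle (hker g hg), hk]⟩
  · rintro ⟨hg, k, hk⟩
    exact ⟨k, by rw [β.nsmul_eq_pow_of_mem_socle (hker g hg), hk]⟩

/-- A nontrivial indecomposable multipermutation solution of square-free cardinality is covered
by the orbits of a primary component of the additive group contained in the socle. -/
theorem HasTower.exists_cover_addSylow {S : YBE X} (h : HasTower S) [Finite X]
    (hind : S.Indecomposable) {β : BraceOps S.permGroup} (hβ : S.IsNaturalBrace β)
    (hsq : Squarefree (Nat.card X)) (hX : Nontrivial X) :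
    ∃ (p : ℕ) (Y : Type u) (T : YBE Y) (f : X → Y), p.Prime ∧ Nat.card X = Nat.card Y * p ∧
      IsCover S T f ∧ HasTower T ∧
      (∀ x x', f x = f x' → ∃ k ∈ β.addSylow p, (k : Equiv.Perm X) x = x') ∧
      ∀ g : S.permGroup, (∀ x, f ((g : Equiv.Perm X) x) = f x) ↔ g ∈ β.addSylow p := by
  obtain ⟨Z, U, h, hU, hinj, hUT⟩ := h.exists_not_injective hX
  obtain ⟨π, γ, hπ, hπf, hker, hγ, hγn⟩ := hU.exists_quotient hβ
  have hZ : Finite Z := Finite.of_surjective h hU.surj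
  have hcomm : ∀ a ∈ π.ker, ∀ b ∈ π.ker, a * b = b * a :=
    fun a ha b hb => β.mul_comm_of_mem_socle (hker a ha) (hker b hb)
  obtain ⟨x, y, hxy, hne⟩ : ∃ x y, h x = h y ∧ x ≠ y := by
    simpa [Function.Injective] using hinj
  have hcard := card_eq_card_mul_card_fiber_of_hom hind hU.surj hU.hom x
  obtain ⟨p, hp, hpd⟩ := Nat.exists_prime_and_dvd (n := Nat.card {a // h a = h x}) (by
    intro h1
    have := (Nat.card_eq_one_iff_unique.1 h1).1.elim ⟨x, rfl⟩ ⟨y, hxy.symm⟩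
    exact hne (congrArg Subtype.val this))
  have : Fact p.Prime := ⟨hp⟩
  have hpZ : ¬ p ∣ Nat.card Z := fun hd =>
    hp.one_lt.ne' (Nat.isUnit_iff.1 (hsq p (hcard ▸ mul_dvd_mul hd hpd)))
  have hpU : ¬ p ∣ Nat.card U.permGroup := fun hd =>
    hpZ (hUT.dvd_card (hind.of_surjective hU.surj hU.hom) hγn hp hd)
  have hpG : p ∣ Nat.card S.permGroup := by
    have : MulAction.IsPretransitive S.permGroup X := ⟨fun a b => by
      obtain ⟨g, hg, h⟩ := hind a b
      exact ⟨⟨g, hg⟩, h⟩⟩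
    rw [← (MulAction.stabilizer S.permGroup x).index_mul_card,
      MulAction.index_stabilizer_of_transitive, hcard]
    exact (hpd.mul_left _).mul_right _
  have hpker : p ∣ Nat.card π.ker := by
    rw [← π.ker.index_mul_card, Subgroup.index_ker, MonoidHom.range_eq_top.2 hπ,
      Subgroup.card_top] at hpG
    exact (hp.dvd_mul.1 hpG).resolve_left hpU
  have hSyl := addSylow_eq_primaryPart hγ hker hcomm hp hpU
  have hPn := primaryPart_normal π.ker hcomm p
  have hPp := primaryPart_isPGroup π.ker hcomm p
  have hPbot := primaryPart_ne_bot π.ker hcomm hp hpker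
  have hPker : ∀ g ∈ primaryPart π.ker hcomm p, π g = 1 := fun g hg => hg.1
  generalize primaryPart π.ker hcomm p = P at *
  have hcov := S.quotient_isCover (orbitSetoid P)
    (by
      rintro a _ ⟨k, hk, rfl⟩
      exact (hβ.σ_apply_of_mem_socle (hker k (hPker k hk)) a).symm)
    (fun z => orbitSetoid_apply_iff P (S.σg z))
  have hle : ∀ a b, orbitSetoid P a b → h a = h b := by
    rintro a _ ⟨k, hk, rfl⟩
    exact ((map_eq_one_iff_forall_apply hU.surj hπf).1 (hPker k hk) a).symm
  have hfib : ∀ a b, Quotient.mk (orbitSetoid P) a = Quotient.mk (orbitSetoid P) b ↔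
      ∃ k ∈ P, (k : Equiv.Perm X) a = b := fun a b => Quotient.eq
  obtain ⟨m, hm⟩ := exists_card_eq_mul_prime_pow hind P hPp hPbot _
    Quotient.mk_surjective hfib
  refine ⟨p, _, _, _, hp, ?_, hcov, ?_, fun a b hab => ?_, fun g => ?_⟩
  · obtain _ | m := m
    · simpa using hm
    · refine absurd (hsq p ?_) (fun h => hp.one_lt.ne' (Nat.isUnit_iff.1 h))
      rw [hm]
      exact Dvd.intro_left (Nat.card (Quotient (orbitSetoid P)) * p ^ m) (by ring)
  · refine .cover _ U (Quotient.lift h hle) ⟨?_, ?_, ?_⟩ hUT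
    · exact fun z => (hU.surj z).imp' (Quotient.mk _) fun _ ha => ha
    · rintro ⟨a⟩ ⟨b⟩
      exact hU.hom a b
    · rintro ⟨a⟩ ⟨b⟩ hab
      apply Equiv.ext
      rintro ⟨c⟩
      exact congrArg (fun e : Equiv.Perm X => Quotient.mk (orbitSetoid P) (e c))
        (hU.σ_eq a b hab)
  · rw [hSyl]
    exact (hfib a b).1 hab
  · rw [hSyl, SetLike.mem_coe]
    constructor
    · intro hg
      have hgker : π g = 1 := (map_eq_one_iff_forall_apply hU.surj hπf).2 fun a =>
        hle _ _ (Quotient.exact (hg a))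
      have hgP : g ^ Nat.card P = 1 := by
        refine Subtype.ext (Equiv.ext fun a => ?_)
        obtain ⟨k, hk, hka⟩ := (hfib _ _).1 (hg a).symm
        have hc : Commute g k := hcomm g hgker k (hPker k hk)
        have hpow : ∀ j : ℕ, ((g ^ j : S.permGroup) : Equiv.Perm X) a =
            ((k ^ j : S.permGroup) : Equiv.Perm X) a := by
          intro j
          induction j with
          | zero => simp
          | succ j ih =>
            have h1 : g * k ^ j = k ^ j * g := (hc.pow_right j)
            calc ((g ^ (j + 1) : S.permGroup) : Equiv.Perm X) a
                = (g : Equiv.Perm X) (((g ^ j : S.permGroup) : Equiv.Perm X) a) := by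
                  rw [pow_succ']; rfl
              _ = ((g * k ^ j : S.permGroup) : Equiv.Perm X) a := by rw [ih]; rfl
              _ = ((k ^ j : S.permGroup) : Equiv.Perm X) ((k : Equiv.Perm X) a) := by
                  rw [h1, hka]; rfl
              _ = ((k ^ (j + 1) : S.permGroup) : Equiv.Perm X) a := by
                  rw [pow_succ]; rfl
        have hk1 : k ^ Nat.card P = 1 :=
          congrArg Subtype.val (pow_card_eq_one' (x := (⟨k, hk⟩ : P)))
        rw [hpow, hk1]
      obtain ⟨e, he⟩ := IsPGroup.iff_card.1 hPp
      have : g ∈ β.addSylow p := ⟨e, by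
        rw [β.nsmul_eq_pow_of_mem_socle (hker g hgker), ← he, hgP]⟩
      rwa [hSyl] at this
    · exact fun hg a => ((hfib _ _).2 ⟨g, hg, rfl⟩).symm

end YBE

namespace BraceOps

variable {G : Type*} [Group G]

/-- The product of the first `i` of the primary components of the additive group of a left
brace, in the order prescribed by `l`. -/
def sylowProd (β : BraceOps G) (l : List ℕ) (i : ℕ) : Set G :=
  ((l.map β.addSylow).take i).prod

theorem sylowProd_zero (β : BraceOps G) (l : List ℕ) : β.sylowProd l 0 = {1} := by
  simp [sylowProd, Set.singleton_one]

theorem isIdeal_singleton_one (β : BraceOps G) : β.IsIdeal {1} := by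
  refine ⟨rfl, ?_, ?_, ?_, ?_⟩ <;> simp [lam_one_right]

theorem IsBraceHom.image_prod [Finite G] {H : Type*} [Group H] {β : BraceOps G} {γ : BraceOps H}
    {π : G →* H} (h : IsBraceHom β γ π) (hπ : Function.Surjective π) (l : List ℕ)
    (hl : ∀ q ∈ l, q.Prime) : π '' (l.map β.addSylow).prod = (l.map γ.addSylow).prod := by
  induction l with
  | nil => simp [Set.singleton_one]
  | cons q l ih =>
    rw [List.forall_mem_cons] at hl
    rw [List.map_cons, List.map_cons, List.prod_cons, List.prod_cons, Set.image_mul, ih hl.2,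
      h.image_addSylow hπ hl.1]

theorem IsBraceHom.sylowProd_cons [Finite G] {H : Type*} [Group H] {β : BraceOps G}
    {γ : BraceOps H} {π : G →* H} (h : IsBraceHom β γ π) (hπ : Function.Surjective π) {p : ℕ}
    (hker : ∀ g, π g = 1 ↔ g ∈ β.addSylow p) (l : List ℕ) (hl : ∀ q ∈ l, q.Prime) (i : ℕ) :
    β.sylowProd (p :: l) (i + 1) = π ⁻¹' γ.sylowProd l i := by
  have himg := h.image_prod hπ (l.take i) fun q hq => hl q (List.mem_of_mem_take hq)
  rw [sylowProd, sylowProd, ← List.map_take, ← List.map_take, ← himg, List.take_succ_cons,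
    List.map_cons, List.prod_cons]
  ext g
  constructor
  · rintro ⟨a, ha, b, hb, rfl⟩
    exact ⟨b, hb, by simp [(hker a).2 ha]⟩
  · rintro ⟨b, hb, hbg⟩
    exact ⟨g * b⁻¹, (hker _).1 (by simp [hbg]), b, hb, by simp⟩

end BraceOps

namespace YBE

variable {X Y : Type u}

/-- The products of the primary components in the order `l` form a socle series of ideals, each
of which is the setwise stabilizer of its orbits. -/
structure IsSocleSeries (S : YBE X) (β : BraceOps S.permGroup) (l : List ℕ) : Prop where
  isIdeal : ∀ i ≤ l.length, β.IsIdeal (β.sylowProd l i)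
  socle : ∀ i < l.length, ∀ a ∈ β.sylowProd l (i + 1), ∀ b,
    (β.add a b)⁻¹ * (a * b) ∈ β.sylowProd l i
  stabilizer : ∀ i ≤ l.length, ∀ g : S.permGroup,
    (∀ x : X, (g : Equiv.Perm X) '' orbSet (β.sylowProd l i) x = orbSet (β.sylowProd l i) x) ↔
      g ∈ β.sylowProd l i

theorem stabilizer_singleton_one {G : Subgroup (Equiv.Perm X)} (g : G) :
    (∀ x : X, (g : Equiv.Perm X) '' orbSet ({1} : Set G) x = orbSet ({1} : Set G) x) ↔
      g ∈ ({1} : Set G) := by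
  have horb : ∀ x : X, orbSet ({1} : Set G) x = {x} := fun x => by
    ext y
    simp [orbSet, eq_comm]
  simp only [horb, Set.image_singleton, Set.singleton_eq_singleton_iff, Set.mem_singleton_iff]
  exact ⟨fun h => Subtype.ext (Equiv.ext h), fun h x => by rw [h]; rfl⟩

theorem IsSocleSeries.nil (S : YBE X) (β : BraceOps S.permGroup) : S.IsSocleSeries β [] := by
  refine ⟨fun i hi => ?_, fun i hi => absurd hi (Nat.not_lt_zero i), fun i hi => ?_⟩
  · rw [Nat.le_zero.1 hi, β.sylowProd_zero]
    exact β.isIdeal_singleton_one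
  · rw [Nat.le_zero.1 hi, β.sylowProd_zero]
    exact stabilizer_singleton_one

theorem orbSet_preimage {S : YBE X} {T : YBE Y} {f : X → Y} {π : S.permGroup →* T.permGroup}
    (hπ : Function.Surjective π)
    (hπf : ∀ (g : S.permGroup) x, f ((g : Equiv.Perm X) x) = (π g : Equiv.Perm Y) (f x))
    (hfib : ∀ x x', f x = f x' → ∃ k : S.permGroup, π k = 1 ∧ (k : Equiv.Perm X) x = x')
    (A : Set T.permGroup) (x : X) : orbSet (π ⁻¹' A) x = f ⁻¹' orbSet A (f x) := by
  ext y
  constructor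
  · rintro ⟨t, ht, rfl⟩
    exact ⟨π t, ht, (hπf t x).symm⟩
  · rintro ⟨t, ht, h⟩
    obtain ⟨t, rfl⟩ := hπ t
    rw [← hπf] at h
    obtain ⟨k, hk, rfl⟩ := hfib _ _ h
    exact ⟨k * t, by simpa [hk] using ht, rfl⟩

theorem IsSocleSeries.cons {S : YBE X} {T : YBE Y} {f : X → Y} {β : BraceOps S.permGroup}
    {γ : BraceOps T.permGroup} {π : S.permGroup →* T.permGroup} [Finite X]
    (hf : Function.Surjective f) (hπ : Function.Surjective π)
    (hπf : ∀ (g : S.permGroup) x, f ((g : Equiv.Perm X) x) = (π g : Equiv.Perm Y) (f x))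
    (hsoc : ∀ g, π g = 1 → g ∈ β.socle) (hγ : BraceOps.IsBraceHom β γ π) {p : ℕ}
    (hker : ∀ g, π g = 1 ↔ g ∈ β.addSylow p)
    (hfib : ∀ x x', f x = f x' → ∃ k : S.permGroup, π k = 1 ∧ (k : Equiv.Perm X) x = x')
    {l : List ℕ} (hl : ∀ q ∈ l, q.Prime) (h : T.IsSocleSeries γ l) :
    S.IsSocleSeries β (p :: l) := by
  have hcons := hγ.sylowProd_cons hπ hker l hl
  refine ⟨fun i hi => ?_, fun i hi a ha b => ?_, fun i hi g => ?_⟩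
  · obtain _ | i := i
    · rw [β.sylowProd_zero]
      exact β.isIdeal_singleton_one
    · rw [hcons]
      exact hγ.isIdeal_preimage (h.isIdeal i (Nat.le_of_succ_le_succ hi))
  · rw [hcons] at ha
    obtain _ | i := i
    · rw [γ.sylowProd_zero] at ha
      rw [β.sylowProd_zero, hsoc a ha b, inv_mul_cancel]
      rfl
    · rw [hcons, Set.mem_preimage, map_mul, map_inv, map_mul, hγ.map_add]
      exact h.socle i (Nat.lt_of_succ_lt_succ hi) _ ha _
  · obtain _ | i := i
    · rw [β.sylowProd_zero]
      exact stabilizer_singleton_one g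
    · rw [hcons, Set.mem_preimage, ← h.stabilizer i (Nat.le_of_succ_le_succ hi), hf.forall]
      refine forall_congr' fun x => ?_
      rw [orbSet_preimage hπ hπf hfib]
      have himg : ∀ B : Set Y, (g : Equiv.Perm X) '' (f ⁻¹' B) =
          f ⁻¹' ((π g : Equiv.Perm Y) '' B) := fun B => by
        ext y
        rw [Equiv.image_eq_preimage_symm, Equiv.image_eq_preimage_symm, Set.mem_preimage,
          Set.mem_preimage, Set.mem_preimage, Set.mem_preimage]
        have : f ((g : Equiv.Perm X).symm y) = (π g : Equiv.Perm Y).symm (f y) := by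
          rw [Equiv.eq_symm_apply, ← hπf, Equiv.apply_symm_apply]
        rw [this]
      rw [himg, hf.preimage_injective.eq_iff]

theorem HasTower.exists_isSocleSeries (m : ℕ) : ∀ {X : Type u} {S : YBE X}, HasTower S →
    S.Indecomposable → ∀ {β : BraceOps S.permGroup}, S.IsNaturalBrace β →
    ∀ s : Finset ℕ, s.card = m → (∀ q ∈ s, q.Prime) → Nat.card X = ∏ q ∈ s, q →
    ∃ l : List ℕ, l.Nodup ∧ (∀ q, q ∈ l ↔ q ∈ s) ∧ S.IsSocleSeries β l := by
  induction m with
  | zero =>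
    intro X S _ _ β _ s hs _ _
    rw [Finset.card_eq_zero] at hs
    exact ⟨[], List.nodup_nil, by simp [hs], .nil S β⟩
  | succ m ih =>
    intro X S hS hind β hβ s hs hprime hcard
    have hpos : 0 < Nat.card X := hcard ▸ Finset.prod_pos fun q hq => (hprime q hq).pos
    have hfin : Finite X := Nat.finite_of_card_ne_zero hpos.ne'
    obtain ⟨q, hq⟩ : s.Nonempty := Finset.card_pos.1 (hs ▸ m.succ_pos)
    have hX : Nontrivial X := Finite.one_lt_card_iff_nontrivial.1 <|
      (hprime q hq).one_lt.trans_le (Nat.le_of_dvd hpos (hcard ▸ Finset.dvd_prod_of_mem _ hq))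
    have hsq : Squarefree (Nat.card X) := by
      rw [hcard]
      refine Finset.squarefree_prod_of_pairwise_isCoprime (fun a ha b hb hab => ?_)
        fun a ha => (hprime a ha).squarefree
      exact Nat.coprime_iff_isRelPrime.1
        ((Nat.coprime_primes (hprime a ha) (hprime b hb)).2 hab)
    obtain ⟨p, Y, T, f, hp, hXY, hf, hT, hfib, hstab⟩ :=
      hS.exists_cover_addSylow hind hβ hsq hX
    obtain ⟨π, γ, hπ, hπf, hsoc, hγ, hγn⟩ := hf.exists_quotient hβ
    have hps : p ∈ s := by
      have : p ∣ ∏ q ∈ s, q := hcard ▸ hXY ▸ Dvd.intro_left _ rfl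
      obtain ⟨a, ha, hpa⟩ := (hp.prime.dvd_finsetProd_iff _).1 this
      rwa [(Nat.prime_dvd_prime_iff_eq hp (hprime a ha)).1 hpa]
    have hker : ∀ g, π g = 1 ↔ g ∈ β.addSylow p := fun g =>
      (map_eq_one_iff_forall_apply hf.surj hπf).trans (hstab g)
    obtain ⟨l, hnd, hl, hser⟩ := ih hT (hind.of_surjective hf.surj hf.hom) hγn (s.erase p)
      (by rw [Finset.card_erase_of_mem hps, hs, Nat.add_sub_cancel])
      (fun q hq => hprime q (Finset.mem_of_mem_erase hq))
      (Nat.eq_of_mul_eq_mul_right hp.pos (by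
        rw [← hXY, hcard, Finset.prod_erase_mul _ _ hps]))
    refine ⟨p :: l, List.nodup_cons.2 ⟨by simp [hl], hnd⟩, fun q => ?_, ?_⟩
    · rw [List.mem_cons, hl, Finset.mem_erase]
      by_cases h : q = p <;> simp [h, hps]
    · refine .cons hf.surj hπ hπf hsoc hγ hker (fun x x' h => ?_)
        (fun q hq => hprime q (Finset.mem_of_mem_erase ((hl q).1 hq))) hser
      obtain ⟨k, hk, hkx⟩ := hfib x x' h
      exact ⟨k, (hker k).2 hk, hkx⟩

end YBE

theorem exists_perm_ofFn_eq {α : Type*} {n : ℕ} {p : Fin n → α} (hp : Function.Injective p)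
    {l : List α} (hnd : l.Nodup) (hl : ∀ a, a ∈ l ↔ a ∈ Set.range p) :
    ∃ τ : Equiv.Perm (Fin n), List.ofFn (fun i => p (τ i)) = l := by
  have hperm : l.Perm (List.ofFn p) :=
    (List.perm_ext_iff_of_nodup hnd (List.nodup_ofFn.2 hp)).2 fun a => by
      rw [hl, List.mem_ofFn, Set.mem_range]
  have hlen : l.length = n := by rw [hperm.length_eq, List.length_ofFn]
  subst hlen
  choose t ht using fun i : Fin l.length => (hl (l.get i)).1 (l.get_mem i)
  have hinj : Function.Injective t := fun i j hij =>
    hnd.injective_get (by rw [← ht, ← ht, hij])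
  refine ⟨Equiv.ofBijective t (Finite.injective_iff_bijective.1 hinj), ?_⟩
  simp only [Equiv.ofBijective_apply, ht, List.ofFn_get]

/-- For an indecomposable multipermutation solution of square-free
cardinality, there is a permutation `τ` of the indices such that the partial products
`P_{τ(1)}⋯P_{τ(i)}` of Sylow subgroups of the additive group of the natural left brace
`𝒢(X,r)` are ideals, `P_{τ(1)}` is contained in the socle, each successive quotient is
contained in the socle of the quotient brace, and
`P_{τ(1)}⋯P_{τ(i)} = {g : g(P_{τ(1)}⋯P_{τ(i)}(x)) = P_{τ(1)}⋯P_{τ(i)}(x) for all x}`. -/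
theorem statement10 {n : ℕ} {X : Type u} (p : Fin n → ℕ)
    (hp : ∀ i, Nat.Prime (p i)) (hinj : Function.Injective p)
    (S : YBE X) (hcard : Nat.card X = Finset.univ.prod p)
    (hind : S.Indecomposable) (hmp : S.IsMultipermutation)
    (β : BraceOps ↥S.permGroup) (hβ : S.IsNaturalBrace β) :
    ∃ τ : Equiv.Perm (Fin n),
      (∀ i : ℕ, 1 ≤ i → i ≤ n → β.IsIdeal (S.sylProdTake β p τ i)) ∧
      S.sylProdTake β p τ 1 ⊆ β.socle ∧
      (∀ i : ℕ, 1 < i → i ≤ n → ∀ a ∈ S.sylProdTake β p τ i, ∀ b : ↥S.permGroup,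
        (β.add a b)⁻¹ * (a * b) ∈ S.sylProdTake β p τ (i - 1)) ∧
      ∀ i : ℕ, 1 ≤ i → i ≤ n → ∀ g : ↥S.permGroup,
        (∀ x : X, ⇑(g : Equiv.Perm X) '' orbSet (S.sylProdTake β p τ i) x =
          orbSet (S.sylProdTake β p τ i) x) ↔ g ∈ S.sylProdTake β p τ i := by
  obtain ⟨m, -, hm⟩ := hmp
  obtain ⟨l, hnd, hl, hser⟩ := hm.hasTower.exists_isSocleSeries _ hind hβ (Finset.univ.image p)
    rfl (by simpa using hp) (by rw [hcard, Finset.prod_image fun i _ j _ h => hinj h])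
  obtain ⟨τ, rfl⟩ := exists_perm_ofFn_eq hinj hnd (by simpa using hl)
  have hprod : ∀ i, S.sylProdTake β p τ i =
      β.sylowProd (List.ofFn fun j => p (τ j)) i := fun i => by
    rw [YBE.sylProdTake, BraceOps.sylowProd, List.map_ofFn]
    rfl
  have hlen : (List.ofFn fun j => p (τ j)).length = n := List.length_ofFn
  refine ⟨τ, fun i _ hi => ?_, fun a ha b => ?_, fun i h1 hi a ha b => ?_, fun i _ hi g => ?_⟩
  · rw [hprod]
    exact hser.isIdeal i (hi.trans_eq hlen.symm)
  · rw [hprod] at ha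
    obtain rfl | hn := n.eq_zero_or_pos
    · have : a = 1 := by simpa [BraceOps.sylowProd] using ha
      rw [this, one_mul, β.zero_add]
    · have := hser.socle 0 (hn.trans_eq hlen.symm) a ha b
      rw [β.sylowProd_zero] at this
      exact (inv_mul_eq_one.1 this).symm
  · obtain _ | i := i
    · exact absurd h1 (Nat.not_lt_zero 1)
    · rw [hprod] at ha ⊢
      exact hser.socle i (Nat.lt_of_lt_of_eq hi hlen.symm) a ha b
  · rw [hprod]
    exact hser.stabilizer i (hi.trans_eq hlen.symm) g
end

section
/- Let n > 2 be an integer, let p_1, …, p_n be n distinct prime numbers, and let (X, r) be an indecomposable involutive non-degenerate set-theoretic solution of the Yang–Baxter equation with |X| = p_1⋯p_n which is a multipermutation solution of multipermutation level n. Then |𝒢(X,r)| > p_1⋯p_n. -/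
open Equiv Pointwise

universe u v

namespace YBE

variable {X : Type u} {Y : Type v}

/-- The additive translation `g ↦ g + σ_x = g ∘ σ_{g⁻¹(x)}` of the permutation group of a
solution. -/
def shift (S : YBE X) (x : X) (g : S.permGroup) : S.permGroup :=
  g * S.σg ((g⁻¹ : S.permGroup).1 x)

theorem shift_left_comm (S : YBE X) (x y : X) (g : S.permGroup) :
    S.shift x (S.shift y g) = S.shift y (S.shift x g) := by
  have h := S.ybe ((g⁻¹ : S.permGroup).1 x) ((g⁻¹ : S.permGroup).1 y)
  apply Subtype.ext
  simpa [shift, σg, mul_assoc] using h.symm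

instance (S : YBE X) : LeftCommutative S.shift := ⟨S.shift_left_comm⟩

theorem shift_mul (S : YBE X) (h g : S.permGroup) (x : X) :
    S.shift (h.1 x) (h * g) = h * S.shift x g := by
  simp [shift, mul_assoc]

theorem foldr_shift_map_mul (S : YBE X) (h g : S.permGroup) (s : Multiset X) :
    (s.map h.1).foldr S.shift (h * g) = h * s.foldr S.shift g := by
  induction s using Multiset.induction_on with
  | empty => simp
  | cons a s ih => rw [Multiset.map_cons, Multiset.foldr_cons, ih, shift_mul, Multiset.foldr_cons]

theorem shift_bijective [Finite X] (S : YBE X) (x : X) : Function.Bijective (S.shift x) := by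
  have := Fintype.ofFinite X
  classical
  refine Finite.surjective_iff_bijective.mp fun g => ?_
  let c : S.permGroup := (Finset.univ : Finset X).val.foldr S.shift 1
  have hc (h : S.permGroup) : (Finset.univ : Finset X).val.foldr S.shift h = h * c := by
    have := S.foldr_shift_map_mul h 1 (Finset.univ : Finset X).val
    rwa [Multiset.map_univ_val_equiv, mul_one] at this
  have hx := hc (g * c⁻¹)
  rw [← Multiset.cons_erase (Finset.mem_val.mpr (Finset.mem_univ x)), Multiset.foldr_cons,
    inv_mul_cancel_right] at hx
  exact ⟨_, hx⟩

/-- The additive translation by `σ_x`, as a permutation. -/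
noncomputable def shiftPerm [Finite X] (S : YBE X) (x : X) : Perm S.permGroup :=
  Equiv.ofBijective _ (S.shift_bijective x)

/-- The group of additive translations of the natural left brace `𝒢(X,r)`. -/
noncomputable def translations [Finite X] (S : YBE X) : Subgroup (Perm S.permGroup) :=
  Subgroup.closure (Set.range S.shiftPerm)

/-- The permutation groups of a solution and of an epimorphic image are the two projections of a
group of pairs of permutations compatible with the epimorphism. -/
theorem IsHom.exists_cover {S : YBE X} {T : YBE Y} {f : X → Y} (hf : S.IsHom T f)
    (hsurj : Function.Surjective f) :
    ∃ K : Subgroup (Perm X × Perm Y), K.map (MonoidHom.fst _ _) = S.permGroup ∧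
      K.map (MonoidHom.snd _ _) = T.permGroup ∧
      ∀ k ∈ K, ∀ x, f (k.1 x) = k.2 (f x) := by
  refine ⟨Subgroup.closure (Set.range fun x => (S.σ x, T.σ (f x))), ?_, ?_, ?_⟩
  · rw [MonoidHom.map_closure, ← Set.range_comp]
    rfl
  · rw [MonoidHom.map_closure, ← Set.range_comp, permGroup, ← hsurj.range_comp T.σ]
    rfl
  · intro k hk
    induction hk using Subgroup.closure_induction with
    | mem k hk =>
      obtain ⟨x, rfl⟩ := hk
      exact hf x
    | one => simp
    | mul a b _ _ iha ihb => simp [iha, ihb]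
    | inv a _ ih =>
      intro x
      rw [Prod.snd_inv, Perm.eq_inv_iff_eq, ← ih]
      simp

theorem IsHom.card_permGroup_dvd {S : YBE X} {T : YBE Y} {f : X → Y} (hf : S.IsHom T f)
    (hsurj : Function.Surjective f) : Nat.card T.permGroup ∣ Nat.card S.permGroup := by
  obtain ⟨K, hS, hT, hK⟩ := hf.exists_cover hsurj
  have hcard : Nat.card K = Nat.card S.permGroup := by
    rw [← hS]
    refine Nat.card_eq_of_bijective _
      ⟨fun k l h => Subtype.ext (Prod.ext (congrArg Subtype.val h) (Equiv.ext fun y => ?_)),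
        (MonoidHom.fst (Perm X) (Perm Y)).subgroupMap_surjective K⟩
    obtain ⟨x, rfl⟩ := hsurj y
    rw [← hK k k.2, ← hK l l.2]
    exact congrArg (fun t => f (t.1 x)) h
  rw [← hcard, ← hT]
  exact K.card_map_dvd _

theorem IsHom.indecomposable {S : YBE X} {T : YBE Y} {f : X → Y} (hf : S.IsHom T f)
    (hsurj : Function.Surjective f) (hind : S.Indecomposable) : T.Indecomposable := by
  obtain ⟨K, hS, hT, hK⟩ := hf.exists_cover hsurj
  intro y z
  obtain ⟨x, rfl⟩ := hsurj y
  obtain ⟨x', rfl⟩ := hsurj z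
  obtain ⟨g, hg, rfl⟩ := hind x x'
  rw [← hS] at hg
  obtain ⟨k, hk, rfl⟩ := hg
  exact ⟨k.2, hT ▸ Subgroup.mem_map_of_mem _ hk, (hK k hk x).symm⟩

section Finite

variable [Finite X] (S : YBE X)

theorem shiftPerm_apply (x : X) (g : S.permGroup) : S.shiftPerm x g = S.shift x g := rfl

theorem shiftPerm_apply_one (x : X) : S.shiftPerm x 1 = S.σg x := by
  simp [shiftPerm_apply, shift]

theorem shiftPerm_mem (x : X) : S.shiftPerm x ∈ S.translations :=
  Subgroup.subset_closure ⟨x, rfl⟩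

theorem conj_shiftPerm (h : S.permGroup) (x : X) :
    MulAut.conj (Equiv.mulLeft h) (S.shiftPerm x) = S.shiftPerm (h.1 x) := by
  ext1 g
  simp only [MulAut.conj_apply, Perm.mul_apply, Equiv.coe_mulLeft, shiftPerm_apply,
    ← shift_mul]
  simp

instance : IsMulCommutative S.translations := by
  refine Subgroup.isMulCommutative_closure ?_
  rintro _ ⟨x, rfl⟩ _ ⟨y, rfl⟩
  ext1 g
  exact S.shift_left_comm x y g

theorem translations_comm {s t : Perm S.permGroup} (hs : s ∈ S.translations)
    (ht : t ∈ S.translations) : s * t = t * s :=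
  congrArg Subtype.val (mul_comm' (⟨s, hs⟩ : S.translations) ⟨t, ht⟩)

theorem conj_mem_translations (h : S.permGroup) {t : Perm S.permGroup}
    (ht : t ∈ S.translations) :
    MulAut.conj (Equiv.mulLeft h) t ∈ S.translations := by
  have : S.translations ≤
      S.translations.comap (MulAut.conj (Equiv.mulLeft h)).toMonoidHom := by
    refine (Subgroup.closure_le _).mpr ?_
    rintro _ ⟨x, rfl⟩
    change MulAut.conj (Equiv.mulLeft h) (S.shiftPerm x) ∈ S.translations
    rw [conj_shiftPerm]
    exact S.shiftPerm_mem _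
  exact this ht

theorem exists_translation_apply_one (g : S.permGroup) :
    ∃ t ∈ S.translations, t 1 = g := by
  obtain ⟨g, hg⟩ := g
  induction hg using Subgroup.closure_induction_right with
  | one => exact ⟨1, one_mem _, rfl⟩
  | mul_right g hg y hy ih =>
    obtain ⟨y, rfl⟩ := hy
    obtain ⟨t, ht, h⟩ := ih
    refine ⟨S.shiftPerm (g y) * t, mul_mem (S.shiftPerm_mem _) ht, ?_⟩
    rw [Perm.mul_apply, h, shiftPerm_apply]
    apply Subtype.ext
    simp [shift, σg]
  | mul_inv_cancel g hg y hy ih =>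
    obtain ⟨y, rfl⟩ := hy
    obtain ⟨t, ht, h⟩ := ih
    refine ⟨(S.shiftPerm (g ((S.σ y)⁻¹ y)))⁻¹ * t,
      mul_mem (inv_mem (S.shiftPerm_mem _)) ht, ?_⟩
    rw [Perm.mul_apply, h, Perm.inv_eq_iff_eq, shiftPerm_apply]
    apply Subtype.ext
    simp [shift, σg]

theorem translation_ext {s t : Perm S.permGroup} (hs : s ∈ S.translations)
    (ht : t ∈ S.translations) (h : s 1 = t 1) : s = t := by
  ext1 g
  obtain ⟨u, hu, rfl⟩ := S.exists_translation_apply_one g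
  rw [← Perm.mul_apply, ← Perm.mul_apply, S.translations_comm hs hu, S.translations_comm ht hu,
    Perm.mul_apply, Perm.mul_apply, h]

theorem card_translations : Nat.card S.translations = Nat.card S.permGroup :=
  Nat.card_eq_of_bijective (fun t : S.translations => t.1 1)
    ⟨fun s t h => Subtype.ext (S.translation_ext s.2 t.2 h), fun g => by
      obtain ⟨t, ht, h⟩ := S.exists_translation_apply_one g
      exact ⟨⟨t, ht⟩, h⟩⟩

theorem isCyclic_translations (hsq : Squarefree (Nat.card S.permGroup)) :
    IsCyclic S.translations := by
  have : IsZGroup S.translations := IsZGroup.of_squarefree (S.card_translations ▸ hsq)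
  have : Group.IsNilpotent S.translations :=
    @CommGroup.isNilpotent S.translations { mul_comm := mul_comm' }
  infer_instance

theorem exists_conj_eq_zpow (hsq : Squarefree (Nat.card S.permGroup)) (h : S.permGroup) :
    ∃ m : ℤ, ∀ t ∈ S.translations, MulAut.conj (Equiv.mulLeft h) t = t ^ m := by
  have := S.isCyclic_translations hsq
  obtain ⟨m, hm⟩ := MonoidHom.map_cyclic
    (((MulAut.conj (Equiv.mulLeft h)).toMonoidHom.comp S.translations.subtype).codRestrict
      S.translations fun t => S.conj_mem_translations h t.2)
  exact ⟨m, fun t ht => congrArg Subtype.val (hm ⟨t, ht⟩)⟩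

theorem σ_eq_of_shiftPerm_eq {x y : X} (h : S.shiftPerm x = S.shiftPerm y) : S.σ x = S.σ y := by
  have := congrArg (fun t : Perm S.permGroup => (t 1).1) h
  simpa [shiftPerm_apply_one, σg] using this

theorem σ_mul_apply_comm (hsq : Squarefree (Nat.card S.permGroup)) (g h : S.permGroup) (x : X) :
    S.σ (g.1 (h.1 x)) = S.σ (h.1 (g.1 x)) := by
  apply S.σ_eq_of_shiftPerm_eq
  obtain ⟨m, hm⟩ := S.exists_conj_eq_zpow hsq g
  obtain ⟨k, hk⟩ := S.exists_conj_eq_zpow hsq h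
  rw [← conj_shiftPerm, ← conj_shiftPerm, ← conj_shiftPerm, ← conj_shiftPerm,
    hk _ (S.shiftPerm_mem x), hm _ (S.shiftPerm_mem x), map_zpow, map_zpow,
    hk _ (S.shiftPerm_mem x), hm _ (S.shiftPerm_mem x), ← zpow_mul, ← zpow_mul, mul_comm]

/-- Commutativity of `t ∘ σ_x = σ_x ∘ t` expressed through additive translations. -/
theorem conj_mul_shiftPerm_of_comm (hcomm : ∀ g h : S.permGroup, g * h = h * g)
    {t : Perm S.permGroup} (ht : t ∈ S.translations) (x : X) :
    MulAut.conj (Equiv.mulLeft (S.σg x)) t * S.shiftPerm x =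
      MulAut.conj (Equiv.mulLeft (t 1)) (S.shiftPerm x) * t := by
  refine S.translation_ext
    (mul_mem (S.conj_mem_translations _ ht) (S.shiftPerm_mem x))
    (mul_mem (S.conj_mem_translations _ (S.shiftPerm_mem x)) ht) ?_
  simp [MulAut.conj_apply, shiftPerm_apply_one, hcomm (t 1)]

theorem Indecomposable.zpowers_shiftPerm {S : YBE X} (hind : S.Indecomposable)
    (hsq : Squarefree (Nat.card S.permGroup)) (x : X) :
    Subgroup.zpowers (S.shiftPerm x) = S.translations := by
  refine le_antisymm (by simpa using S.shiftPerm_mem x) ((Subgroup.closure_le _).mpr ?_)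
  rintro _ ⟨y, rfl⟩
  obtain ⟨g, hg, rfl⟩ := hind x y
  obtain ⟨m, hm⟩ := S.exists_conj_eq_zpow hsq ⟨g, hg⟩
  exact ⟨m, ((hm _ (S.shiftPerm_mem x)).symm.trans (S.conj_shiftPerm ⟨g, hg⟩ x))⟩

theorem Indecomposable.σ_eq_of_comm {S : YBE X} (hind : S.Indecomposable)
    (hsq : Squarefree (Nat.card S.permGroup))
    (hcomm : ∀ g h : S.permGroup, g * h = h * g) (x y : X) : S.σ x = S.σ y := by
  obtain ⟨g, hg, rfl⟩ := hind x y
  apply S.σ_eq_of_shiftPerm_eq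
  set a := S.shiftPerm x with ha
  have hz := hind.zpowers_shiftPerm hsq x
  have hord : orderOf a = Nat.card S.permGroup := by
    rw [← card_translations, ← hz, Nat.card_zpowers]
  obtain ⟨m, hm⟩ := S.exists_conj_eq_zpow hsq (S.σg x)
  have key (i : ℤ) :
      MulAut.conj (Equiv.mulLeft ((a ^ i) 1)) a = a ^ (1 + (m - 1) * i) := by
    have hi : a ^ i ∈ S.translations := zpow_mem (S.shiftPerm_mem x) i
    have h := S.conj_mul_shiftPerm_of_comm hcomm hi x
    rw [hm _ hi, ← ha] at h
    rw [eq_mul_inv_of_mul_eq h.symm]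
    group
  have hdvd : (orderOf a : ℤ) ∣ m - 1 := by
    have hsqa : Squarefree (orderOf a) := hord ▸ hsq
    rw [Int.natCast_dvd, ← Nat.prod_primeFactors_of_squarefree hsqa]
    refine Finset.prod_primes_dvd _ (fun p hp => (Nat.prime_of_mem_primeFactors hp).prime)
      fun p hp => ?_
    have hp' := Nat.prime_of_mem_primeFactors hp
    by_contra hpc
    rw [← Int.natCast_dvd] at hpc
    obtain ⟨u, v, huv⟩ := (Nat.prime_iff_prime_int.mp hp').coprime_iff_not_dvd.mpr hpc
    have hk := key (-v)
    rw [show 1 + (m - 1) * -v = u * p by linear_combination -huv] at hk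
    obtain ⟨q, hq⟩ := Nat.dvd_of_mem_primeFactors hp
    have hone : MulAut.conj (Equiv.mulLeft ((a ^ (-v)) 1)) (a ^ q) = 1 := by
      rw [map_pow, hk, ← zpow_natCast, ← zpow_mul, mul_assoc, ← Nat.cast_mul, ← hq, mul_comm,
        zpow_mul, zpow_natCast, pow_orderOf_eq_one, one_zpow]
    rw [map_eq_one_iff _ (MulEquiv.injective _), ← orderOf_dvd_iff_pow_eq_one] at hone
    have hq0 : 0 < q := Nat.pos_of_ne_zero fun h0 => hsqa.ne_zero (by simp [hq, h0])
    have := Nat.le_of_dvd hq0 hone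
    nlinarith [hp'.two_le]
  obtain ⟨t, ht, htg⟩ := S.exists_translation_apply_one ⟨g, hg⟩
  rw [← hz] at ht
  obtain ⟨i, rfl⟩ := ht
  have h := key i
  simp only at htg
  rw [htg, conj_shiftPerm, zpow_add, zpow_one, zpow_mul,
    orderOf_dvd_iff_zpow_eq_one.mp hdvd, one_zpow, mul_one] at h
  exact h.symm

theorem IsRetract.permGroup_comm {S : YBE X} {T : YBE Y}
    (hret : S.IsRetract T) (hsq : Squarefree (Nat.card S.permGroup)) (g h : T.permGroup) :
    g * h = h * g := by
  obtain ⟨f, hsurj, hf, hfib⟩ := hret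
  obtain ⟨K, hS, hT, hK⟩ := hf.exists_cover hsurj
  obtain ⟨g, hg⟩ := g
  obtain ⟨h, hh⟩ := h
  rw [← hT] at hg hh
  obtain ⟨k, hk, rfl⟩ := hg
  obtain ⟨l, hl, rfl⟩ := hh
  apply Subtype.ext
  ext1 y
  obtain ⟨x, rfl⟩ := hsurj y
  have := S.σ_mul_apply_comm hsq ⟨k.1, hS ▸ Subgroup.mem_map_of_mem _ hk⟩
    ⟨l.1, hS ▸ Subgroup.mem_map_of_mem _ hl⟩ x
  rw [← hfib, hK k hk, hK l hl, hK l hl, hK k hk] at this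
  exact this

end Finite

theorem mpLevelLE_one_of_σ_eq {Z : Type u} [Nonempty Z] (T : YBE Z)
    (h : ∀ x y, T.σ x = T.σ y) : MPLevelLE 1 Z T :=
  ⟨PUnit, ⟨fun _ => 1, fun _ _ => rfl⟩,
    ⟨fun _ => PUnit.unit, fun _ => ⟨Classical.arbitrary Z, rfl⟩, fun _ _ => rfl,
      fun x y => ⟨fun _ => h x y, fun _ => rfl⟩⟩, inferInstance, inferInstance⟩

end YBE

/-- For `n > 2`, an indecomposable solution of cardinality `p 0 ⋯ p (n-1)`
(distinct primes) of multipermutation level exactly `n` has `|𝒢(X,r)| > p 0 ⋯ p (n-1)`. -/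
theorem statement16 {n : ℕ} (hn : 2 < n) {X : Type u} (p : Fin n → ℕ)
    (hp : ∀ i, Nat.Prime (p i)) (hinj : Function.Injective p)
    (S : YBE X) (hcard : Nat.card X = Finset.univ.prod p)
    (hind : S.Indecomposable) (hlev : S.MPLevelExact n) :
    Finset.univ.prod p < Nat.card ↥S.permGroup := by
  have hpos : 0 < Nat.card X := hcard ▸ Finset.prod_pos fun i _ => (hp i).pos
  obtain ⟨hne, hfin⟩ := Nat.card_pos_iff.mp hpos
  by_contra! hle
  have hsq : Squarefree (Finset.univ.prod p) := by
    refine Finset.squarefree_prod_of_pairwise_isCoprime (fun i _ j _ hij => ?_)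
      fun i _ => (hp i).squarefree
    exact Nat.coprime_iff_isRelPrime.mp ((Nat.coprime_primes (hp i) (hp j)).mpr (hinj.ne hij))
  have hdvd : Nat.card X ∣ Nat.card S.permGroup := by
    have : MulAction.IsPretransitive S.permGroup X :=
      ⟨fun x y => (hind x y).elim fun g hg => ⟨⟨g, hg.1⟩, hg.2⟩⟩
    rw [← MulAction.index_stabilizer_of_transitive S.permGroup (Classical.arbitrary X)]
    exact Subgroup.index_dvd_card _
  have hsqG : Squarefree (Nat.card S.permGroup) := by
    rwa [le_antisymm hle (hcard ▸ Nat.le_of_dvd Nat.card_pos hdvd)]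
  obtain ⟨k, rfl⟩ := Nat.exists_eq_add_of_lt hn
  obtain ⟨Z, T, hret, -⟩ := hlev.2.1
  have hcomm := hret.permGroup_comm hsqG
  obtain ⟨f, hsurj, hf, -⟩ := id hret
  have : Finite Z := Finite.of_surjective f hsurj
  have : Nonempty Z := hne.map f
  have hT : YBE.MPLevelLE 1 Z T := T.mpLevelLE_one_of_σ_eq <|
    (hf.indecomposable hsurj hind).σ_eq_of_comm
      (hsqG.squarefree_of_dvd (hf.card_permGroup_dvd hsurj)) hcomm
  exact absurd (hlev.2.2 2 two_pos ⟨Z, T, hret, hT⟩) (by omega)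
end

section
/- Let p_1, …, p_n be distinct prime numbers and let (X, r) be an indecomposable involutive non-degenerate set-theoretic solution of the Yang–Baxter equation with |X| = p_1⋯p_n. Then every prime dividing the order of 𝒢(X,r) belongs to {p_1, …, p_n}, and for each i the Sylow p_i-subgroups of the group 𝒢(X,r) are elementary abelian p_i-groups. -/
open Equiv Pointwise

universe u v

namespace Complex

theorem norm_multiset_sum_le_card {s : Multiset ℂ} (hs : ∀ μ ∈ s, ‖μ‖ = 1) :
    ‖s.sum‖ ≤ s.card := by
  refine (_root_.norm_multiset_sum_le s).trans ?_
  have h := Multiset.sum_le_card_nsmul (s.map fun μ => ‖μ‖) 1 (by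
    intro x hx
    obtain ⟨μ, hμ, rfl⟩ := Multiset.mem_map.mp hx
    exact (hs μ hμ).le)
  simpa using h

/-- Equality in the triangle inequality for complex numbers of norm one. -/
theorem exists_forall_eq_of_norm_sum_eq {s : Multiset ℂ} (hs : ∀ μ ∈ s, ‖μ‖ = 1)
    (hsum : ‖s.sum‖ = s.card) : ∃ ζ, ∀ μ ∈ s, μ = ζ := by
  set w := s.sum with hw
  refine ⟨(s.card : ℂ) / starRingEnd ℂ w, fun μ hμ => ?_⟩
  have hpos : (0 : ℝ) < s.card := by
    exact_mod_cast Multiset.card_pos_iff_exists_mem.mpr ⟨μ, hμ⟩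
  have hw0 : starRingEnd ℂ w ≠ 0 := by
    rw [Ne, map_eq_zero, ← norm_eq_zero, hsum]
    exact hpos.ne'
  have hnorm : ∀ ν ∈ s, ‖ν * starRingEnd ℂ w‖ = s.card := fun ν hν => by
    rw [norm_mul, hs ν hν, RCLike.norm_conj, hsum, one_mul]
  have hle : ∀ ν ∈ s, (ν * starRingEnd ℂ w).re ≤ s.card := fun ν hν =>
    hnorm ν hν ▸ re_le_norm _
  have hre : (μ * starRingEnd ℂ w).re = s.card := by
    refine le_antisymm (hle μ hμ) ?_
    obtain ⟨t, rfl⟩ := Multiset.exists_cons_of_mem hμ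
    have h1 : (w * starRingEnd ℂ w).re = ((μ ::ₘ t).card : ℝ) * (μ ::ₘ t).card := by
      rw [mul_conj, ofReal_re, normSq_eq_norm_sq, hsum, sq]
    have h2 : w * starRingEnd ℂ w = μ * starRingEnd ℂ w
        + (t.map fun ν => ν * starRingEnd ℂ w).sum := by
      rw [Multiset.sum_map_mul_right, Multiset.map_id', ← add_mul, ← Multiset.sum_cons]
    have h3 : ((t.map fun ν => ν * starRingEnd ℂ w).sum).re ≤ t.card * (μ ::ₘ t).card := by
      rw [← coe_reAddGroupHom, map_multiset_sum, Multiset.map_map]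
      have h := Multiset.sum_le_card_nsmul
        (t.map (reAddGroupHom ∘ fun ν => ν * starRingEnd ℂ w)) ((μ ::ₘ t).card : ℝ) (by
          intro x hx
          obtain ⟨ν, hν, rfl⟩ := Multiset.mem_map.mp hx
          exact hle ν (Multiset.mem_cons_of_mem hν))
      rwa [Multiset.card_map, nsmul_eq_mul] at h
    rw [h2, add_re] at h1
    rw [Multiset.card_cons] at *
    push_cast at *
    linarith
  have him : (μ * starRingEnd ℂ w).im = 0 := by
    have h := normSq_apply (μ * starRingEnd ℂ w)
    rw [normSq_eq_norm_sq, hnorm μ hμ, hre] at h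
    nlinarith
  rw [eq_div_iff hw0]
  exact Complex.ext (by simpa using hre) (by simpa using him)

/-- If the average of finitely many roots of unity is an algebraic integer, then it vanishes or
they all agree. -/
theorem sum_eq_zero_or_exists_forall_eq {s : Multiset ℂ} {n : ℕ} (hn : n ≠ 0)
    (hs : ∀ μ ∈ s, μ ^ n = 1) (hint : IsIntegral ℤ (s.sum / s.card)) :
    s.sum = 0 ∨ ∃ ζ, ∀ μ ∈ s, μ = ζ := by
  rcases eq_or_ne s.sum 0 with h0 | h0
  · exact Or.inl h0
  refine Or.inr (exists_forall_eq_of_norm_sum_eq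
    (fun μ hμ => norm_eq_one_of_pow_eq_one (hs μ hμ) hn) ?_)
  have hcard : s.card ≠ 0 := fun h => h0 (by rw [Multiset.card_eq_zero.mp h, Multiset.sum_zero])
  let K := IntermediateField.adjoin ℚ {μ : ℂ | μ ∈ s}
  have hsK : ∀ μ ∈ s, μ ∈ K := fun μ hμ => IntermediateField.subset_adjoin ℚ _ hμ
  have hfin : FiniteDimensional ℚ K := by
    have : Finite {μ : ℂ | μ ∈ s} := s.finite_toSet
    refine IntermediateField.finiteDimensional_adjoin fun μ hμ => ?_
    exact ⟨Polynomial.X ^ n - 1, Polynomial.monic_X_pow_sub_C 1 hn, by simp [hs μ hμ]⟩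
  have : NumberField K := { to_charZero := inferInstance, to_finiteDimensional := hfin }
  let t : Multiset K := s.attach.map fun μ => ⟨μ.1, hsK μ.1 μ.2⟩
  have htn : ∀ z ∈ t, z ^ n = 1 := fun z hz => by
    obtain ⟨μ, -, rfl⟩ := Multiset.mem_map.mp hz
    exact Subtype.ext (hs μ.1 μ.2)
  have htcard : t.card = s.card := by simp [t]
  have htsum : (algebraMap K ℂ) t.sum = s.sum := by
    rw [map_multiset_sum, Multiset.map_map]
    exact congrArg Multiset.sum s.attach_map_val
  set a : K := t.sum / s.card with ha
  have haC : algebraMap K ℂ a = s.sum / s.card := by rw [ha, map_div₀, htsum, map_natCast]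
  have hcard' : (s.card : ℂ) ≠ 0 := by exact_mod_cast hcard
  have ha0 : a ≠ 0 := by
    rintro h
    rw [h, map_zero] at haC
    exact div_ne_zero h0 hcard' haC.symm
  have haint : IsIntegral ℤ a := by
    rw [← isIntegral_algebraMap_iff (algebraMap K ℂ).injective, haC]
    exact hint
  obtain ⟨m, hm, hm1⟩ := NumberField.Embeddings.pow_eq_one_of_norm_le_one K ℂ ha0 haint
    fun φ => by
      have h := norm_multiset_sum_le_card (s := t.map φ) (by
        intro x hx
        obtain ⟨z, hz, rfl⟩ := Multiset.mem_map.mp hx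
        refine norm_eq_one_of_pow_eq_one (n := n) ?_ hn
        rw [← map_pow, htn z hz, map_one])
      rw [Multiset.card_map, htcard, ← map_multiset_sum] at h
      rw [ha, map_div₀, map_natCast, norm_div, norm_natCast]
      exact div_le_one_of_le₀ h (Nat.cast_nonneg _)
  have h1 : ‖s.sum / (s.card : ℂ)‖ = 1 := by
    rw [← haC]
    refine norm_eq_one_of_pow_eq_one (n := m) ?_ hm.ne'
    rw [← map_pow, hm1, map_one]
  rw [norm_div, norm_natCast, div_eq_one_iff_eq (by exact_mod_cast hcard)] at h1
  exact h1

end Complex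

namespace Matrix

variable {d : ℕ} {M : Matrix (Fin d) (Fin d) ℂ} {n : ℕ}

theorem pow_eq_one_of_mem_roots_charpoly (hM : M ^ n = 1) {μ : ℂ}
    (hμ : μ ∈ M.charpoly.roots) : μ ^ n = 1 := by
  have h := Matrix.mem_spectrum_of_isRoot_charpoly (Polynomial.isRoot_of_mem_roots hμ)
  have h2 := spectrum.pow_mem_pow M n h
  rw [hM] at h2
  have : Nontrivial (Matrix (Fin d) (Fin d) ℂ) := by
    by_contra hsub
    rw [not_nontrivial_iff_subsingleton] at hsub
    rw [spectrum.of_subsingleton] at h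
    exact h
  rwa [spectrum.one_eq, Set.mem_singleton_iff] at h2

theorem isIntegral_trace_of_pow_eq_one (hn : n ≠ 0) (hM : M ^ n = 1) :
    IsIntegral ℤ M.trace := by
  rw [trace_eq_sum_roots_charpoly]
  refine IsIntegral.multiset_sum fun μ hμ => ?_
  exact ⟨Polynomial.X ^ n - 1, Polynomial.monic_X_pow_sub_C 1 hn, by
    simp [pow_eq_one_of_mem_roots_charpoly hM hμ]⟩

/-- A matrix of finite order whose normalized trace is integral has trace zero or is scalar. -/
theorem trace_eq_zero_or_eq_algebraMap [NeZero d] (hn : n ≠ 0) (hM : M ^ n = 1)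
    (hint : IsIntegral ℤ (M.trace / d)) : M.trace = 0 ∨ ∃ ζ : ℂ, M = algebraMap ℂ _ ζ := by
  have hsplit : M.charpoly.Splits := IsAlgClosed.splits _
  have hcard : M.charpoly.roots.card = d := by
    rw [← hsplit.natDegree_eq_card_roots, charpoly_natDegree_eq_dim, Fintype.card_fin]
  have htr := trace_eq_sum_roots_charpoly M
  have h := Complex.sum_eq_zero_or_exists_forall_eq hn
    (fun μ => pow_eq_one_of_mem_roots_charpoly hM) (by rwa [hcard, ← htr])
  rw [← htr] at h
  refine h.imp_right fun ⟨ζ, hζ⟩ => ⟨ζ, ?_⟩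
  have hchar : M.charpoly = (Polynomial.X - Polynomial.C ζ) ^ d := by
    conv_lhs => rw [hsplit.eq_prod_roots_of_monic M.charpoly_monic,
      Multiset.eq_replicate_card.mpr hζ, hcard]
    simp
  have hsq : Squarefree (minpoly ℂ M) := by
    refine Squarefree.squarefree_of_dvd (minpoly.dvd ℂ M (p := Polynomial.X ^ n - 1) (by simp [hM]))
      (Polynomial.Separable.squarefree ?_)
    rw [Polynomial.X_pow_sub_one_separable_iff]
    exact_mod_cast hn
  have hdvd := minpoly_dvd_charpoly M
  rw [hchar, hsq.dvd_pow_iff_dvd (NeZero.ne d), minpoly.dvd_iff] at hdvd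
  simpa [sub_eq_zero] using hdvd

end Matrix

theorem map_pow_natCard_eq_one {G M : Type*} [Group G] [Monoid M] (ρ : G →* M) (g : G) :
    ρ g ^ Nat.card G = 1 := by
  rw [← map_pow, pow_card_eq_one', map_one]

section CharacterDegree

variable {G : Type*} [Group G] [Finite G] {d : ℕ} {ρ : G →* Matrix (Fin d) (Fin d) ℂ}

theorem isIntegral_of_sum_eq_algebraMap [NeZero d] {S : Finset G} {ω : ℂ}
    (h : ∑ x ∈ S, ρ x = algebraMap ℂ _ ω) : IsIntegral ℤ ω := by
  have hz : IsIntegral ℤ (∑ x ∈ S, MonoidAlgebra.single x (1 : ℤ)) := IsIntegral.of_finite ℤ _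
  have h2 := hz.map (MonoidAlgebra.lift ℤ _ G ρ)
  rw [map_sum] at h2
  simp only [MonoidAlgebra.lift_single, one_smul] at h2
  rw [h] at h2
  exact (isIntegral_algebraMap_iff (algebraMap ℂ (Matrix (Fin d) (Fin d) ℂ)).injective).mp h2

/-- A class of size coprime to the degree of an absolutely irreducible matrix representation has
vanishing trace or acts by a scalar. -/
theorem trace_eq_zero_or_eq_algebraMap_of_coprime [NeZero d]
    (hirr : ∀ M, (∀ h, Commute M (ρ h)) → ∃ ζ : ℂ, M = algebraMap ℂ _ ζ) {g : G}
    {S : Finset G} (hS : ∀ x, x ∈ S ↔ IsConj g x) (hcop : S.card.Coprime d) :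
    (ρ g).trace = 0 ∨ ∃ ζ : ℂ, ρ g = algebraMap ℂ _ ζ := by
  have hd : (d : ℂ) ≠ 0 := Nat.cast_ne_zero.mpr (NeZero.ne d)
  have hconj : ∀ (h x : G), IsConj g x → IsConj g (h * x * h⁻¹) := fun h x hx =>
    hx.trans (isConj_iff.mpr ⟨h, rfl⟩)
  obtain ⟨ω, hω⟩ := hirr (∑ x ∈ S, ρ x) fun h => by
    rw [Commute, SemiconjBy, Finset.sum_mul, Finset.mul_sum]
    refine (Finset.sum_bij (fun x _ => h * x * h⁻¹)
      (fun x hx => (hS _).mpr (hconj h x ((hS x).mp hx))) (fun a _ b _ hab => by simpa using hab)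
      (fun x hx => ⟨h⁻¹ * x * h, (hS _).mpr ?_, by group⟩) fun x _ => ?_).symm
    · simpa using hconj h⁻¹ x ((hS x).mp hx)
    · rw [← map_mul, ← map_mul, inv_mul_cancel_right]
  have hωint := isIntegral_of_sum_eq_algebraMap hω
  have htr : ∀ x ∈ S, (ρ x).trace = (ρ g).trace := fun x hx => by
    obtain ⟨c, rfl⟩ := isConj_iff.mp ((hS x).mp hx)
    rw [map_mul, Matrix.trace_mul_comm, ← map_mul, ← mul_assoc,
      inv_mul_cancel, one_mul]
  have hωd : ω * d = S.card * (ρ g).trace := by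
    have h := congrArg Matrix.trace hω
    rw [Matrix.trace_sum, Finset.sum_congr rfl htr, Finset.sum_const, nsmul_eq_mul,
      Algebra.algebraMap_eq_smul_one, Matrix.trace_smul, Matrix.trace_one, Fintype.card_fin,
      smul_eq_mul] at h
    exact h.symm
  refine Matrix.trace_eq_zero_or_eq_algebraMap Nat.card_pos.ne' (map_pow_natCard_eq_one ρ g) ?_
  have hbez : (1 : ℂ) = S.card * (Nat.gcdA S.card d : ℤ) + d * (Nat.gcdB S.card d : ℤ) := by
    have h := Nat.gcd_eq_gcd_ab S.card d
    rw [hcop.gcd_eq_one] at h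
    exact_mod_cast h
  have heq : (ρ g).trace / d
      = (Nat.gcdA S.card d : ℤ) * ω + (Nat.gcdB S.card d : ℤ) * (ρ g).trace := by
    rw [div_eq_iff hd]
    linear_combination (ρ g).trace * hbez - (Nat.gcdA S.card d : ℂ) * hωd
  rw [heq]
  have hchi : IsIntegral ℤ (ρ g).trace :=
    Matrix.isIntegral_trace_of_pow_eq_one Nat.card_pos.ne' (map_pow_natCard_eq_one ρ g)
  exact (isIntegral_algebraMap.mul hωint).add (isIntegral_algebraMap.mul hchi)

theorem exists_isIntegral_natCast_mul_trace_eq [IsSimpleGroup G] [NeZero d]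
    (hirr : ∀ M, (∀ h, Commute M (ρ h)) → ∃ ζ : ℂ, M = algebraMap ℂ _ ζ) {g : G}
    {S : Finset G} (hS : ∀ x, x ∈ S ↔ IsConj g x) {p k : ℕ} (hp : p.Prime) (hk : k ≠ 0)
    (hcard : S.card = p ^ k) [Fintype G] :
    ∃ α : ℂ, IsIntegral ℤ α ∧
      d * (ρ g).trace = d * (∑ h, ρ h).trace / Nat.card G + p * α := by
  have hG : (Nat.card G : ℂ) ≠ 0 := Nat.cast_ne_zero.mpr Nat.card_pos.ne'
  by_cases htriv : ∀ h, ρ h = 1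
  · refine ⟨0, isIntegral_zero, ?_⟩
    simp only [htriv, Finset.sum_const, Matrix.trace_smul, Finset.card_univ, mul_zero, add_zero]
    rw [← Nat.card_eq_fintype_card, nsmul_eq_mul]
    field_simp
  push Not at htriv
  obtain ⟨h₀, hh₀⟩ := htriv
  have hker : ρ.ker = ⊥ := by
    refine (Subgroup.Normal.eq_bot_or_eq_top inferInstance).resolve_right fun h => hh₀ ?_
    have : h₀ ∈ ρ.ker := h ▸ Subgroup.mem_top _
    exact this
  have hmul : ∀ h, ρ h * ∑ x, ρ x = ∑ x, ρ x := fun h => by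
    rw [Finset.mul_sum]
    exact Fintype.sum_equiv (Equiv.mulLeft h) _ _ fun x => (map_mul ρ h x).symm
  have hmul' : ∀ h, (∑ x, ρ x) * ρ h = ∑ x, ρ x := fun h => by
    rw [Finset.sum_mul]
    exact Fintype.sum_equiv (Equiv.mulRight h) _ _ fun x => (map_mul ρ x h).symm
  have hzero : ∑ x, ρ x = 0 := by
    obtain ⟨t, ht⟩ := hirr (∑ x, ρ x) fun h => (hmul' h).trans (hmul h).symm
    rcases eq_or_ne t 0 with rfl | ht0
    · rw [ht, map_zero]
    · have h := hmul h₀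
      rw [ht, Algebra.algebraMap_eq_smul_one, mul_smul_one] at h
      exact absurd (smul_right_injective _ ht0 h) hh₀
  rw [hzero, Matrix.trace_zero, mul_zero, zero_div]
  simp only [zero_add]
  by_cases hpd : p ∣ d
  · obtain ⟨m, rfl⟩ := hpd
    refine ⟨m * (ρ g).trace, (isIntegral_algebraMap (R := ℤ) (x := (m : ℤ))).mul
      (Matrix.isIntegral_trace_of_pow_eq_one Nat.card_pos.ne' (map_pow_natCard_eq_one ρ g)), ?_⟩
    push_cast
    ring
  rcases trace_eq_zero_or_eq_algebraMap_of_coprime hirr hS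
    (hcard ▸ Nat.Coprime.pow_left k ((hp.coprime_iff_not_dvd).mpr hpd)) with h0 | ⟨ζ, hζ⟩
  · exact ⟨0, isIntegral_zero, by rw [h0]; simp⟩
  exfalso
  have hS1 : S = {g} := by
    refine Finset.eq_singleton_iff_unique_mem.mpr ⟨(hS g).mpr (IsConj.refl g), fun x hx => ?_⟩
    obtain ⟨c, rfl⟩ := isConj_iff.mp ((hS x).mp hx)
    refine (MonoidHom.ker_eq_bot_iff ρ).mp hker ?_
    rw [map_mul, map_mul, hζ, ← Algebra.commutes, mul_assoc, ← map_mul, mul_inv_cancel, map_one,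
      mul_one]
  rw [hS1, Finset.card_singleton] at hcard
  exact absurd hcard.symm (Nat.one_lt_pow hk hp.one_lt).ne'

end CharacterDegree

namespace LinearMap

theorem trace_eq_sum_repr {R M ι : Type*} [CommRing R] [AddCommGroup M] [Module R M] [Fintype ι]
    (b : Module.Basis ι R M) (f : M →ₗ[R] M) : trace R M f = ∑ i, b.repr (f (b i)) i := by
  classical
  rw [trace_eq_matrix_trace R b, Matrix.trace]
  exact Finset.sum_congr rfl fun i _ => by rw [Matrix.diag_apply, toMatrix_apply]

theorem trace_mulLeft_pi_matrix {R : Type*} [CommRing R] {n : ℕ} {d : Fin n → ℕ}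
    (a : Π i, Matrix (Fin (d i)) (Fin (d i)) R) :
    trace R _ (mulLeft R a) = ∑ i, d i * (a i).trace := by
  classical
  rw [trace_eq_sum_repr (Pi.basis fun i => Matrix.stdBasis R (Fin (d i)) (Fin (d i))),
    Fintype.sum_sigma]
  refine Finset.sum_congr rfl fun i _ => ?_
  have h : ∀ x : Fin (d i) × Fin (d i),
      (Pi.basis fun i => Matrix.stdBasis R (Fin (d i)) (Fin (d i))).repr
        (mulLeft R a (Pi.basis (fun i => Matrix.stdBasis R (Fin (d i)) (Fin (d i))) ⟨i, x⟩))
        ⟨i, x⟩ = a i x.1 x.1 := fun x => by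
    rw [Pi.basis_repr, Pi.basis_apply, mulLeft_apply, Pi.mul_apply, Pi.single_eq_same,
      Matrix.stdBasis_eq_single]
    simp [Matrix.stdBasis]
  rw [Finset.sum_congr rfl fun x _ => h x, Fintype.sum_prod_type]
  simp [Matrix.trace, Finset.mul_sum]

theorem trace_mulLeft_single {G : Type*} [Group G] [Fintype G] [DecidableEq G] {R : Type*}
    [CommRing R] (g : G) :
    trace R _ (mulLeft R (MonoidAlgebra.single g (1 : R))) =
      if g = 1 then (Nat.card G : R) else 0 := by
  rw [trace_eq_sum_repr (MonoidAlgebra.basis G R)]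
  have h : ∀ x : G, (MonoidAlgebra.basis G R).repr (mulLeft R (MonoidAlgebra.single g (1 : R))
      (MonoidAlgebra.basis G R x)) x = if g = 1 then 1 else 0 := fun x => by
    rw [MonoidAlgebra.basis_apply, mulLeft_apply, MonoidAlgebra.single_mul_single, one_mul,
      ← MonoidAlgebra.basis_apply, Module.Basis.repr_self, Finsupp.single_apply]
    simp
  rw [Finset.sum_congr rfl fun x _ => h x, Finset.sum_const, Finset.card_univ,
    ← Nat.card_eq_fintype_card]
  split_ifs <;> simp

end LinearMap

/-- A finite simple group has no conjugacy class of nontrivial prime power size. -/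
theorem not_isSimpleGroup_of_card_eq_prime_pow {G : Type*} [Group G] [Finite G] {g : G}
    {S : Finset G} (hS : ∀ x, x ∈ S ↔ IsConj g x) {p k : ℕ} (hp : p.Prime) (hk : k ≠ 0)
    (hcard : S.card = p ^ k) : ¬ IsSimpleGroup G := by
  classical
  intro hsimple
  have := Fintype.ofFinite G
  have hG : (Nat.card G : ℂ) ≠ 0 := Nat.cast_ne_zero.mpr Nat.card_pos.ne'
  have : NeZero (Nat.card G : ℂ) := ⟨hG⟩
  obtain ⟨n, d, hd, ⟨φ⟩⟩ :=
    IsSemisimpleRing.exists_algEquiv_pi_matrix_of_isAlgClosed ℂ (MonoidAlgebra ℂ G)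
  let ρ : ∀ i, G →* Matrix (Fin (d i)) (Fin (d i)) ℂ := fun i =>
    (((Pi.evalAlgHom ℂ _ i).comp φ.toAlgHom : MonoidAlgebra ℂ G →ₐ[ℂ] _) : _ →* _).comp
      (MonoidAlgebra.of ℂ G)
  have hρ : ∀ i h, ρ i h = φ (MonoidAlgebra.single h 1) i := fun _ _ => rfl
  have hirr : ∀ i M, (∀ h, Commute M (ρ i h)) → ∃ ζ : ℂ, M = algebraMap ℂ _ ζ := by
    intro i M hM
    have hall : ∀ x, Commute M (φ x i) := fun x => by
      induction x using MonoidAlgebra.induction_on with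
      | of h => exact hM h
      | add x y hx hy => rw [map_add]; exact hx.add_right hy
      | smul r x hx => rw [map_smul]; exact hx.smul_right r
    obtain ⟨ζ, hζ⟩ := Matrix.mem_range_scalar_of_commute_single (M := M) fun a b _ => by
      have h := hall (φ.symm (Pi.single i (Matrix.single a b 1)))
      rw [φ.apply_symm_apply, Pi.single_eq_same] at h
      exact h.symm
    exact ⟨ζ, hζ.symm⟩
  have htrace : ∀ h, ∑ i, d i * (ρ i h).trace = if h = 1 then (Nat.card G : ℂ) else 0 := fun h => by
    rw [← LinearMap.trace_mulLeft_single (R := ℂ) h,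
      ← LinearMap.trace_conj' _ φ.toLinearEquiv]
    have hc : φ.toLinearEquiv.conj (LinearMap.mulLeft ℂ (MonoidAlgebra.single h (1 : ℂ)))
        = LinearMap.mulLeft ℂ (φ (MonoidAlgebra.single h (1 : ℂ))) := by
      refine LinearMap.ext fun x => ?_
      rw [LinearEquiv.conj_apply_apply]
      simp
    rw [hc, LinearMap.trace_mulLeft_pi_matrix]
    rfl
  have hg : g ≠ 1 := by
    rintro rfl
    have hS1 : S = {1} := Finset.ext fun x => by rw [hS, isConj_one_right, Finset.mem_singleton]
    rw [hS1, Finset.card_singleton] at hcard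
    exact absurd hcard.symm (Nat.one_lt_pow hk hp.one_lt).ne'
  choose α hα hαeq using fun i =>
    exists_isIntegral_natCast_mul_trace_eq (ρ := ρ i) (hirr i) hS hp hk hcard
  have h0 := htrace g
  rw [if_neg hg, Finset.sum_congr rfl fun i _ => hαeq i, Finset.sum_add_distrib,
    ← Finset.sum_div, ← Finset.mul_sum] at h0
  have h1 : ∑ i, d i * (∑ h, ρ i h).trace = (Nat.card G : ℂ) := by
    simp only [Matrix.trace_sum, Finset.mul_sum]
    rw [Finset.sum_comm, Finset.sum_congr rfl fun h _ => htrace h]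
    simp
  rw [h1, div_self hG] at h0
  have hpC : (p : ℂ) ≠ 0 := Nat.cast_ne_zero.mpr hp.ne_zero
  have hint : IsIntegral ℤ (algebraMap ℚ ℂ (-1 / p)) := by
    have hsum : algebraMap ℚ ℂ (-1 / p) = ∑ i, α i := by
      rw [map_div₀, map_neg, map_one, map_natCast, div_eq_iff hpC]
      linear_combination -h0
    rw [hsum]
    exact IsIntegral.sum _ fun i _ => hα i
  rw [isIntegral_algebraMap_iff (algebraMap ℚ ℂ).injective,
    IsIntegrallyClosed.isIntegral_iff] at hint
  obtain ⟨y, hy⟩ := hint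
  rw [eq_div_iff (Nat.cast_ne_zero.mpr hp.ne_zero)] at hy
  have hy' : y * (p : ℤ) = -1 := by
    have : ((y * p : ℤ) : ℚ) = ((-1 : ℤ) : ℚ) := by
      push_cast
      exact hy
    exact_mod_cast this
  have hdvd : (p : ℤ) ∣ 1 := ⟨-y, by linarith⟩
  exact hp.one_lt.ne' (Nat.dvd_one.mp (by exact_mod_cast hdvd))

theorem Subgroup.relIndex_dvd_relIndex_of_normal {G : Type*} [Group G] [Finite G]
    {S M T : Subgroup G} [M.Normal] (hS : S ≤ T) (hM : M ≤ T) :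
    S.relIndex M ∣ S.relIndex T := by
  have h1 := relIndex_mul_relIndex ⊥ (S ⊓ M) M bot_le inf_le_right
  have h2 := relIndex_mul_relIndex ⊥ (S ⊓ M) S bot_le inf_le_left
  have h3 := relIndex_mul_relIndex ⊥ M (S ⊔ M) bot_le le_sup_right
  have h4 := relIndex_mul_relIndex ⊥ S (S ⊔ M) bot_le le_sup_left
  rw [inf_relIndex_right] at h1
  rw [inf_relIndex_left] at h2
  rw [relIndex_sup_right, ← h1, ← h4, ← h2] at h3
  have hpos : 0 < relIndex ⊥ (S ⊓ M) := by rw [relIndex_bot_left]; exact Nat.card_pos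
  have hpos' : 0 < M.relIndex S :=
    Nat.pos_of_ne_zero (M.subgroupOf S).index_ne_zero_of_finite
  have h5 : S.relIndex (S ⊔ M) = S.relIndex M := by
    apply Nat.eq_of_mul_eq_mul_left (Nat.mul_pos hpos hpos')
    rw [← h3]; ring
  rw [← h5, ← relIndex_mul_relIndex S (S ⊔ M) T le_sup_left (sup_le hS hM)]
  exact Dvd.intro _ rfl

theorem Subgroup.relIndex_dvd_index_of_normal_right {G : Type*} [Group G] [Finite G]
    (S M : Subgroup G) [M.Normal] : S.relIndex M ∣ S.index := by
  rw [← relIndex_top_right]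
  exact relIndex_dvd_relIndex_of_normal le_top le_top

theorem Subgroup.index_dvd_of_isConj_finset {G : Type*} [Group G] [Finite G] {g : G}
    {S : Finset G} (hS : ∀ x, x ∈ S ↔ IsConj g x) {P : Subgroup G} (hP : ∀ x ∈ P, x * g = g * x) :
    S.card ∣ P.index := by
  have hcoe : MulAction.orbit (ConjAct G) g = (S : Set G) := by
    ext x
    rw [ConjAct.orbit_eq_carrier_conjClasses, ConjClasses.mem_carrier_iff_mk_eq,
      ConjClasses.mk_eq_mk_iff_isConj, Finset.mem_coe, hS, isConj_comm]
  have h := MulAction.index_stabilizer (ConjAct G) g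
  rw [hcoe, Set.ncard_coe_finset] at h
  rw [← h, ← index_map_equiv P (ConjAct.toConjAct (G := G))]
  refine index_dvd_of_le ?_
  rintro _ ⟨x, hx, rfl⟩
  rw [MulAction.mem_stabilizer_iff]
  change x * g * x⁻¹ = g
  rw [hP x hx, mul_inv_cancel_right]

theorem Subgroup.card_lt_card_of_ne_top {G : Type*} [Group G] [Finite G] {H : Subgroup G}
    (h : H ≠ ⊤) : Nat.card H < Nat.card G :=
  lt_of_le_of_ne (Nat.le_of_dvd Nat.card_pos H.card_subgroup_dvd_card)
    fun he => h (H.eq_top_of_card_eq he)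

theorem Subgroup.card_quotient_lt_card_of_ne_bot {G : Type*} [Group G] [Finite G] {H : Subgroup G}
    (h : H ≠ ⊥) : Nat.card (G ⧸ H) < Nat.card G := by
  have h1 := one_lt_card_iff_ne_bot H |>.mpr h
  have h2 : 0 < Nat.card (G ⧸ H) := Nat.card_pos
  rw [card_eq_card_quotient_mul_card_subgroup H]
  nlinarith

/-- **Burnside's theorem**: a finite group whose order has at most two prime divisors is
solvable. -/
theorem isSolvable_of_forall_prime_dvd_card {p q : ℕ} {G : Type u} [Group G] [Finite G]
    (h : ∀ r : ℕ, r.Prime → r ∣ Nat.card G → r = p ∨ r = q) : Group.IsSolvable G := by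
  induction hn : Nat.card G using Nat.strong_induction_on generalizing G with
  | _ n ih =>
    subst hn
    have hstep : ∀ N : Subgroup G, N.Normal → N ≠ ⊥ → N ≠ ⊤ → Group.IsSolvable G :=
      fun N hN hbot htop => by
        rw [Group.isSolvable_iff_subgroup_quotient N]
        exact ⟨ih _ (Subgroup.card_lt_card_of_ne_top htop)
            (fun r hr hrd => h r hr (hrd.trans N.card_subgroup_dvd_card)) rfl,
          ih _ (Subgroup.card_quotient_lt_card_of_ne_bot hbot)
            (fun r hr hrd => h r hr (hrd.trans N.card_quotient_dvd_card)) rfl⟩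
    by_cases hp : p.Prime ∧ p ∣ Nat.card G
    · obtain ⟨hp, hpd⟩ := hp
      have : Fact p.Prime := ⟨hp⟩
      let P : Sylow p G := default
      have hPcard : p ∣ Nat.card P := P.dvd_card_of_dvd_card hpd
      have : Nontrivial P := Finite.one_lt_card_iff_nontrivial.mp
        (hp.one_lt.trans_le (Nat.le_of_dvd Nat.card_pos hPcard))
      have := P.isPGroup'.center_nontrivial
      obtain ⟨⟨z, hz⟩, hz1⟩ := exists_ne (1 : Subgroup.center P)
      rw [Subgroup.mem_center_iff] at hz
      have hzP : ∀ x ∈ (P : Subgroup G), x * (z : G) = z * x := fun x hx =>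
        congrArg Subtype.val (hz ⟨x, hx⟩)
      have hz1' : (z : G) ≠ 1 := fun h => hz1 (Subtype.ext (Subtype.ext h))
      set S : Finset G := (Set.toFinite {x | IsConj (z : G) x}).toFinset with hSdef
      have hS : ∀ x, x ∈ S ↔ IsConj (z : G) x := fun x => by simp [hSdef]
      have hdvd := Subgroup.index_dvd_of_isConj_finset hS hzP
      have hprime : ∀ {r : ℕ}, r.Prime → r ∣ S.card → r = q := fun {r} hr hrd =>
        (h r hr ((hrd.trans hdvd).trans (Subgroup.index_dvd_card _))).resolve_left
          fun hrp => by
            subst hrp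
            exact P.not_dvd_index (hrd.trans hdvd)
      have hpow := Nat.eq_prime_pow_of_unique_prime_dvd (n := S.card) (p := q)
        (Finset.card_ne_zero.mpr ⟨(z : G), (hS _).mpr (IsConj.refl _)⟩) hprime
      by_cases hk : S.card = 1
      · have hzc : (z : G) ∈ Subgroup.center G := by
          rw [Subgroup.mem_center_iff]
          intro x
          have h1 : x * z * x⁻¹ = z := Finset.card_le_one.mp hk.le _
            ((hS _).mpr (isConj_iff.mpr ⟨x, rfl⟩)) _ ((hS _).mpr (IsConj.refl _))
          exact mul_inv_eq_iff_eq_mul.mp h1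
        by_cases htop : Subgroup.center G = ⊤
        · refine Group.isSolvable_of_comm fun a b => ?_
          exact (Subgroup.mem_center_iff.mp (htop ▸ Subgroup.mem_top b) a)
        · refine hstep _ inferInstance (fun hbot => hz1' ?_) htop
          rwa [hbot, Subgroup.mem_bot] at hzc
      · obtain ⟨r, hr, hrd⟩ := Nat.exists_prime_and_dvd hk
        have hrq : r = q := hprime hr hrd
        have hns := not_isSimpleGroup_of_card_eq_prime_pow hS (p := q)
          (k := S.card.primeFactorsList.length) (hrq ▸ hr)
          (fun h0 => hk (by rw [hpow, h0, pow_zero])) hpow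
        have : Nontrivial G := ⟨⟨_, _, hz1'⟩⟩
        by_contra hsol
        exact hns ⟨fun N hN => by
          by_contra! hN'
          exact hsol (hstep N hN hN'.1 hN'.2)⟩
    · have hpow := Nat.eq_prime_pow_of_unique_prime_dvd (n := Nat.card G) (p := q)
        Nat.card_pos.ne' (fun {r} hr hrd => (h r hr hrd).resolve_left
          (fun hrp => hp (hrp ▸ ⟨hr, hrd⟩)))
      by_cases hk : Nat.card G = 1
      · have := (Nat.card_eq_one_iff_unique.mp hk).1
        infer_instance
      · obtain ⟨r, hr, hrd⟩ := Nat.exists_prime_and_dvd hk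
        have : Fact q.Prime := ⟨(h r hr hrd).resolve_left (fun hrp => hp (hrp ▸ ⟨hr, hrd⟩)) ▸ hr⟩
        have := (IsPGroup.of_card hpow).isNilpotent
        infer_instance

theorem exists_normal_isPGroup {G : Type*} [Group G] [Finite G] [Group.IsSolvable G]
    [Nontrivial G] :
    ∃ q : ℕ, q.Prime ∧ ∃ M : Subgroup G, M.Normal ∧ M ≠ ⊥ ∧ IsPGroup q M := by
  obtain ⟨A, hA, hA0, hcomm⟩ : ∃ A : Subgroup G, A.Normal ∧ A ≠ ⊥ ∧
      ∀ a ∈ A, ∀ b ∈ A, a * b = b * a := by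
    classical
    have hex : ∃ n, derivedSeries G n = ⊥ := Group.IsSolvable.solvable
    obtain ⟨m, hm⟩ : ∃ m, Nat.find hex = m + 1 := Nat.exists_eq_succ_of_ne_zero fun h0 => by
      have h := Nat.find_spec hex
      rw [h0, derivedSeries_zero] at h
      exact top_ne_bot h
    refine ⟨derivedSeries G m, inferInstance, Nat.find_min hex (by omega), fun a ha b hb => ?_⟩
    have h := Nat.find_spec hex
    rw [hm, derivedSeries_succ, Subgroup.commutator_eq_bot_iff_le_centralizer] at h
    exact (Subgroup.mem_centralizer_iff.mp (h ha) b hb).symm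
  obtain ⟨q, hq, hqd⟩ := Nat.exists_prime_and_dvd (fun h => hA0 (Subgroup.card_eq_one.mp h))
  have : Fact q.Prime := ⟨hq⟩
  obtain ⟨x, hx⟩ := exists_prime_orderOf_dvd_card' (G := A) q hqd
  refine ⟨q, hq,
    { carrier := {a | a ∈ A ∧ a ^ q = 1}
      one_mem' := ⟨A.one_mem, one_pow q⟩
      mul_mem' := fun {a b} ha hb => ⟨A.mul_mem ha.1 hb.1, by
        rw [Commute.mul_pow (hcomm a ha.1 b hb.1), ha.2, hb.2, one_mul]⟩
      inv_mem' := fun {a} ha => ⟨A.inv_mem ha.1, by rw [inv_pow, ha.2, inv_one]⟩ },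
    ⟨fun a ha g => ⟨hA.conj_mem a ha.1 g, by rw [conj_pow, ha.2, mul_one, mul_inv_cancel]⟩⟩,
    fun hbot => ?_, fun a => ⟨1, by rw [pow_one]; exact Subtype.ext a.2.2⟩⟩
  have hmem : (x : G) ∈ (⊥ : Subgroup G) := hbot ▸ ⟨x.2, by
    rw [← Subgroup.coe_pow, ← hx, pow_orderOf_eq_one, Subgroup.coe_one]⟩
  rw [Subgroup.mem_bot, OneMemClass.coe_eq_one] at hmem
  rw [hmem, orderOf_one] at hx
  exact hq.one_lt.ne hx

theorem Subgroup.relIndex_eq_index_of_coprime {G : Type*} [Group G] [Finite G] {H K : Subgroup G}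
    (h : K.index.Coprime H.index) : K.relIndex H = K.index := by
  have h1 := relIndex_mul_index (inf_le_left : H ⊓ K ≤ H)
  have h2 := relIndex_mul_index (inf_le_right : H ⊓ K ≤ K)
  rw [inf_relIndex_left] at h1
  rw [← h1] at h2
  refine le_antisymm ?_ (Nat.le_of_dvd (Nat.pos_of_ne_zero index_ne_zero_of_finite)
    (h.dvd_of_dvd_mul_right ⟨_, h2.symm.trans (mul_comm _ _)⟩))
  rw [← relIndex_top_right]
  exact relIndex_le_of_le_right le_top index_ne_zero_of_finite

/-- A finite group having a `p`-complement for every prime `p` is solvable. -/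
theorem isSolvable_of_hall {G : Type u} [Group G] [Finite G]
    (h : ∀ p : ℕ, p.Prime → ∃ H : Subgroup G, (Nat.card H).Coprime p ∧ ∃ k, H.index = p ^ k) :
    Group.IsSolvable G := by
  induction hn : Nat.card G using Nat.strong_induction_on generalizing G with
  | _ n ih =>
    subst hn
    have hcompl : ∀ p : ℕ, p.Prime → p ∣ Nat.card G → ∀ H : Subgroup G, (Nat.card H).Coprime p →
        (∃ k, H.index = p ^ k) → Group.IsSolvable H := by
      rintro p hp hpG H hH ⟨k, hk⟩
      refine ih _ (Subgroup.card_lt_card_of_ne_top ?_) (fun j hj => ?_) rfl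
      · rintro rfl
        rw [Subgroup.card_top] at hH
        exact hp.one_lt.ne' (Nat.eq_one_of_dvd_coprimes hH hpG dvd_rfl)
      rcases eq_or_ne j p with rfl | hjp
      · exact ⟨⊤, by rwa [Subgroup.card_top], 0, by rw [Subgroup.index_top, pow_zero]⟩
      obtain ⟨K, hK, l, hl⟩ := h j hj
      refine ⟨K.subgroupOf H, ?_, l, ?_⟩
      · refine Nat.Coprime.coprime_dvd_left ?_ hK
        have h1 := Subgroup.card_dvd_of_le (inf_le_left : K ⊓ H ≤ K)
        rwa [← Subgroup.subgroupOf_map_subtype, Subgroup.card_map_of_injective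
            H.subtype_injective] at h1
      · change K.relIndex H = _
        rw [Subgroup.relIndex_eq_index_of_coprime, hl]
        rw [hl, hk]
        exact Nat.Coprime.pow _ _ ((Nat.coprime_primes hj hp).mpr hjp)
    by_cases h1 : Nat.card G = 1
    · have := (Nat.card_eq_one_iff_unique.mp h1).1
      infer_instance
    obtain ⟨p, hp, hpG⟩ := Nat.exists_prime_and_dvd h1
    obtain ⟨H, hH, hk⟩ := h p hp
    have hHsol := hcompl p hp hpG H hH hk
    by_cases hnt : Nontrivial H
    swap
    · rw [Subgroup.nontrivial_iff_ne_bot, not_not] at hnt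
      obtain ⟨k, hk⟩ := hk
      rw [hnt, Subgroup.index_bot] at hk
      have : Fact p.Prime := ⟨hp⟩
      have := (IsPGroup.of_card hk).isNilpotent
      infer_instance
    obtain ⟨r, hr, M, hMn, hM0, hMr⟩ := exists_normal_isPGroup (G := H)
    by_cases hj : ∀ j : ℕ, j.Prime → j ∣ Nat.card G → j = p ∨ j = r
    · exact isSolvable_of_forall_prime_dvd_card hj
    push Not at hj
    obtain ⟨j, hj, hjG, hjp, hjr⟩ := hj
    obtain ⟨K, hK, l, hl⟩ := h j hj
    have hKsol := hcompl j hj hjG K hK ⟨l, hl⟩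
    have hle : ∀ L : Subgroup G, L.index = K.index → M.map H.subtype ≤ L := fun L hL => by
      rw [Subgroup.map_le_iff_le_comap]
      change M ≤ L.subgroupOf H
      rw [← Subgroup.relIndex_eq_one]
      have := hMn
      have hd1 := Subgroup.relIndex_dvd_index_of_normal_right (L.subgroupOf H) M
      have hd2 := Subgroup.relIndex_dvd_card (L.subgroupOf H) M
      have : Fact r.Prime := ⟨hr⟩
      obtain ⟨m, hm⟩ := IsPGroup.iff_card.mp hMr
      obtain ⟨k, hk⟩ := hk
      refine Nat.eq_one_of_dvd_coprimes ?_ hd1 hd2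
      change (L.relIndex H).Coprime _
      rw [Subgroup.relIndex_eq_index_of_coprime, hL, hl, hm]
      · exact Nat.Coprime.pow _ _ ((Nat.coprime_primes hj hr).mpr hjr)
      · rw [hL, hl, hk]
        exact Nat.Coprime.pow _ _ ((Nat.coprime_primes hj hp).mpr hjp)
    have hcore : M.map H.subtype ≤ K.normalCore := fun x hx g =>
      hle (K.comap (MulAut.conj g).toMonoidHom)
        (Subgroup.index_comap_of_surjective K (MulAut.conj g).surjective) hx
    have hcore0 : K.normalCore ≠ ⊥ := fun h0 => hM0 (by
      rw [h0, le_bot_iff, Subgroup.map_eq_bot_iff_of_injective _ H.subtype_injective] at hcore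
      exact hcore)
    rw [Group.isSolvable_iff_subgroup_quotient K.normalCore]
    refine ⟨Group.isSolvable_of_isSolvable_injective
      (Subgroup.inclusion_injective K.normalCore_le),
      ih _ (Subgroup.card_quotient_lt_card_of_ne_bot hcore0) (fun i hi => ?_) rfl⟩
    obtain ⟨L, hL, m, hm⟩ := h i hi
    have hsurj := QuotientGroup.mk'_surjective K.normalCore
    obtain ⟨m', -, hm'⟩ := (Nat.dvd_prime_pow hi).mp (hm ▸ L.index_map_dvd hsurj)
    exact ⟨L.map (QuotientGroup.mk' K.normalCore),
      Nat.Coprime.coprime_dvd_left (Subgroup.card_map_dvd _ _) hL, m', hm'⟩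

/-- A left brace: a group and an abelian group on the same type, linked by
`a * (b + c) = a * b - a + a * c`. -/
class IsLeftBrace (B : Type*) [Group B] [AddCommGroup B] : Prop where
  mul_add_eq : ∀ a b c : B, a * (b + c) = a * b - a + a * c

namespace IsLeftBrace

section Basic

variable {B : Type*} [Group B] [AddCommGroup B] [IsLeftBrace B]

theorem mul_zero_eq (a : B) : a * 0 = a := by
  have h := mul_add_eq a 0 0
  rw [add_zero] at h
  have h2 : a * 0 - a = 0 := by
    have := congrArg (fun x => x - a * 0) h
    simpa using this.symm
  exact sub_eq_zero.mp h2

theorem one_eq_zero : (1 : B) = 0 := by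
  have := mul_zero_eq (1 : B)
  rw [one_mul] at this
  exact this.symm

theorem mul_neg_eq (a b : B) : a * -b = a - a * b + a := by
  have h := mul_add_eq a b (-b)
  rw [add_neg_cancel, mul_zero_eq] at h
  have : a * -b = a - (a * b - a) := by
    rw [eq_sub_iff_add_eq, add_comm]
    exact h.symm
  rw [this]
  abel

/-- The lambda map `λ_a(b) = -a + a * b`. -/
def lam : B →* AddMonoid.End B where
  toFun a :=
    { toFun := fun b => -a + a * b
      map_zero' := by rw [mul_zero_eq, neg_add_cancel]
      map_add' := fun b c => by rw [mul_add_eq]; abel }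
  map_one' := by
    ext b
    change -(1 : B) + 1 * b = b
    rw [one_mul, one_eq_zero, neg_zero, zero_add]
  map_mul' a b := by
    ext c
    change -(a * b) + a * b * c = -a + a * (-b + b * c)
    rw [mul_add_eq, mul_neg_eq, mul_assoc]
    abel

theorem lam_apply (a b : B) : lam a b = -a + a * b := rfl

theorem mul_eq (a b : B) : a * b = a + lam a b := by
  rw [lam_apply, add_neg_cancel_left]

theorem lam_mul_apply (a b c : B) : lam (a * b) c = lam a (lam b c) := by
  rw [map_mul]; rfl

theorem lam_one_apply (b : B) : lam (1 : B) b = b := by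
  rw [map_one]; rfl

@[simp]
theorem lam_inv_lam (a b : B) : lam a⁻¹ (lam a b) = b := by
  rw [← lam_mul_apply, inv_mul_cancel, lam_one_apply]

@[simp]
theorem lam_lam_inv (a b : B) : lam a (lam a⁻¹ b) = b := by
  rw [← lam_mul_apply, mul_inv_cancel, lam_one_apply]

theorem lam_injective (a : B) : Function.Injective (lam a) :=
  fun x y h => by rw [← lam_inv_lam a x, h, lam_inv_lam]

theorem add_eq (a b : B) : a + b = a * lam a⁻¹ b := by
  rw [mul_eq, lam_lam_inv]

/-- The stabilizer of `e` under the lambda action. -/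
def stab (e : B) : Subgroup B where
  carrier := {g | lam g e = e}
  one_mem' := lam_one_apply e
  mul_mem' {a b} ha hb := by
    change lam (a * b) e = e
    rw [lam_mul_apply, show lam b e = e from hb, show lam a e = e from ha]
  inv_mem' {a} ha := by
    change lam a⁻¹ e = e
    conv_lhs => rw [← show lam a e = e from ha]
    exact lam_inv_lam a e

theorem mem_stab {e g : B} : g ∈ stab e ↔ lam g e = e := Iff.rfl

theorem stab_le_stab_nsmul (z : ℕ) (e : B) : stab e ≤ stab (z • e) := fun g hg => by
  rw [mem_stab] at *
  rw [map_nsmul, hg]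

theorem index_stab (e : B) : (stab e).index = Nat.card (Set.range fun g => lam g e) := by
  let _ : MulAction B B :=
    { smul := fun g b => lam g b
      one_smul := lam_one_apply
      mul_smul := lam_mul_apply }
  have h := MulAction.index_stabilizer B e
  rw [← Nat.card_coe_set_eq] at h
  exact h

/-- The lambda orbit of `e` generates the additive group. -/
def Generates (e : B) : Prop :=
  ∀ A : AddSubgroup B, (∀ g, lam g e ∈ A) → A = ⊤

theorem Generates.lam_eq_one {e : B} (he : Generates e) {x : B}
    (hx : ∀ g : B, g⁻¹ * x * g ∈ stab e) : lam x = 1 := by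
  have h := he (AddMonoidHom.eqLocus (lam x) (AddMonoidHom.id B)) fun g => by
    change lam x (lam g e) = lam g e
    rw [← lam_mul_apply, show x * g = g * (g⁻¹ * x * g) by group, lam_mul_apply,
      mem_stab.mp (hx g)]
  ext b
  have hb : b ∈ AddMonoidHom.eqLocus (lam x) (AddMonoidHom.id B) := h ▸ AddSubgroup.mem_top b
  exact hb

/-- The elements annihilated by `n` in the additive group of a brace, as a multiplicative
subgroup. -/
def tors (B : Type*) [Group B] [AddCommGroup B] [IsLeftBrace B] (n : ℕ) : Subgroup B where
  carrier := {b | n • b = 0}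
  one_mem' := by
    change n • (1 : B) = 0
    rw [one_eq_zero, smul_zero]
  mul_mem' {a b} ha hb := by
    change n • (a * b) = 0
    rw [mul_eq, smul_add, show n • a = 0 from ha, ← map_nsmul, show n • b = 0 from hb, map_zero,
      add_zero]
  inv_mem' {a} ha := by
    change n • a⁻¹ = 0
    apply lam_injective a
    have h : lam a a⁻¹ = -a := by
      rw [lam_apply, mul_inv_cancel, one_eq_zero, add_zero]
    rw [map_nsmul, h, smul_neg, show n • a = 0 from ha, neg_zero, map_zero]

theorem mem_tors {n : ℕ} {b : B} : b ∈ tors B n ↔ n • b = 0 := Iff.rfl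

theorem lam_mem_tors {n : ℕ} {b : B} (a : B) (hb : b ∈ tors B n) : lam a b ∈ tors B n := by
  rw [mem_tors] at *
  rw [← map_nsmul, hb, map_zero]

theorem sub_mem_tors {n : ℕ} {a b : B} (ha : a ∈ tors B n) (hb : b ∈ tors B n) :
    a - b ∈ tors B n := by
  rw [mem_tors] at *
  rw [smul_sub, ha, hb, sub_zero]

instance (n : ℕ) : AddCommGroup (tors B n) :=
  inferInstanceAs (AddCommGroup (nsmulAddMonoidHom n : B →+ B).ker)

theorem coe_add_tors {n : ℕ} (a b : tors B n) : ((a + b : tors B n) : B) = a + b := rfl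

theorem coe_neg_tors {n : ℕ} (a : tors B n) : ((-a : tors B n) : B) = -a := rfl

instance (n : ℕ) : IsLeftBrace (tors B n) where
  mul_add_eq a b c := Subtype.ext (mul_add_eq (a : B) b c)

theorem coe_lam_tors {n : ℕ} (a b : tors B n) : ((lam a b : tors B n) : B) = lam (a : B) b := rfl

theorem eq_zero_of_mem_tors {n m : ℕ} (hnm : n.Coprime m) {b : B} (hn : b ∈ tors B n)
    (hm : b ∈ tors B m) : b = 0 := by
  rw [mem_tors] at *
  have h1 := addOrderOf_dvd_of_nsmul_eq_zero hn
  have h2 := addOrderOf_dvd_of_nsmul_eq_zero hm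
  exact AddMonoid.addOrderOf_eq_one_iff.mp (Nat.eq_one_of_dvd_coprimes hnm h1 h2)

end Basic

section Coprime

variable {B : Type*} [Group B] [AddCommGroup B] [IsLeftBrace B]

theorem exists_add_of_coprime {n m : ℕ} (hnm : n.Coprime m) (hB : Nat.card B = n * m) (b : B) :
    ∃ c ∈ tors B m, ∃ a ∈ tors B n, b = c + a := by
  have h0 : (n * m) • b = 0 := by rw [← hB]; exact card_nsmul_eq_zero'
  have hz : ((n : ℤ) * m) • b = 0 := by exact_mod_cast h0
  have hbez := Nat.gcd_eq_gcd_ab n m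
  rw [hnm] at hbez
  refine ⟨((n : ℤ) * n.gcdA m) • b, ?_, ((m : ℤ) * n.gcdB m) • b, ?_, ?_⟩
  · rw [mem_tors, ← natCast_zsmul, ← mul_smul,
      show (m : ℤ) * (n * n.gcdA m) = n.gcdA m * (n * m) by ring, mul_smul, hz, smul_zero]
  · rw [mem_tors, ← natCast_zsmul, ← mul_smul,
      show (n : ℤ) * (m * n.gcdB m) = n.gcdB m * (n * m) by ring, mul_smul, hz, smul_zero]
  · rw [← add_smul, ← hbez, Nat.cast_one, one_smul]

theorem exists_mul_of_coprime {n m : ℕ} (hnm : n.Coprime m) (hB : Nat.card B = n * m) (b : B) :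
    ∃ c ∈ tors B m, ∃ a ∈ tors B n, b = c * a := by
  obtain ⟨c, hc, a, ha, rfl⟩ := exists_add_of_coprime hnm hB b
  exact ⟨c, hc, lam c⁻¹ a, lam_mem_tors _ ha, add_eq c a⟩

theorem card_tors_coprime [Finite B] {n m : ℕ} (hnm : n.Coprime m) :
    (Nat.card (tors B n)).Coprime m := by
  refine Nat.Coprime.symm (Nat.coprime_of_dvd fun p hp hpm hpn => ?_)
  have : Fact p.Prime := ⟨hp⟩
  obtain ⟨x, hx⟩ := exists_prime_addOrderOf_dvd_card' (G := tors B n) p hpn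
  have hxn : n • x = 0 := Subtype.ext x.2
  have : p ∣ n := hx ▸ addOrderOf_dvd_of_nsmul_eq_zero hxn
  exact Nat.not_coprime_of_dvd_of_dvd hp.one_lt this hpm hnm

theorem card_tors [Finite B] {n m : ℕ} (hnm : n.Coprime m) (hB : Nat.card B = n * m) :
    Nat.card (tors B n) = n := by
  have hbij : Function.Bijective fun x : tors B m × tors B n => (x.1 : B) + x.2 := by
    constructor
    · rintro ⟨c, a⟩ ⟨c', a'⟩ h
      have h' : (c : B) - c' = a' - a := by
        rw [sub_eq_sub_iff_add_eq_add, add_comm (a' : B)]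
        exact h
      have h0 := eq_zero_of_mem_tors hnm (h' ▸ sub_mem_tors a'.2 a.2) (sub_mem_tors c.2 c'.2)
      have h1 := sub_eq_zero.mp h0
      rw [h1, sub_self] at h'
      exact Prod.ext (Subtype.ext h1) (Subtype.ext (sub_eq_zero.mp h'.symm).symm)
    · intro b
      obtain ⟨c, hc, a, ha, rfl⟩ := exists_add_of_coprime hnm hB b
      exact ⟨(⟨c, hc⟩, ⟨a, ha⟩), rfl⟩
  have hcard := Nat.card_congr (Equiv.ofBijective _ hbij)
  rw [Nat.card_prod, hB] at hcard
  have h1 : Nat.card (tors B n) ∣ n :=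
    (card_tors_coprime hnm).dvd_of_dvd_mul_right (hcard ▸ Dvd.intro_left _ rfl)
  have h2 : Nat.card (tors B m) ∣ m :=
    (card_tors_coprime hnm.symm).dvd_of_dvd_mul_left (hcard ▸ Dvd.intro _ rfl)
  have hpos : 0 < n * m := hB ▸ Nat.card_pos
  have hn : 0 < n := Nat.pos_of_mul_pos_right hpos
  have hm : 0 < m := Nat.pos_of_mul_pos_left hpos
  refine le_antisymm (Nat.le_of_dvd hn h1) ?_
  have := Nat.le_of_dvd hm h2
  nlinarith

end Coprime

section Transport

variable {M G : Type*} [AddCommMonoid M] [Group G]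

/-- A group carries a left brace structure as soon as it is the image of a commutative monoid `M`
on which it acts, under a map that turns twisted sums into products. -/
theorem exists_of_surjective (act : G →* AddMonoid.End M) (L : M → G)
    (hsurj : Function.Surjective L) (hL : ∀ a b, L (a + act (L a) b) = L a * L b) :
    ∃ (_ : AddCommGroup G) (_ : IsLeftBrace G), (∀ a b, L (a + b) = L a + L b) ∧
      ∀ g b, lam g (L b) = L (act g b) := by
  have hact : ∀ g b, act g (act g⁻¹ b) = b := fun g b => by
    change (act g * act g⁻¹) b = b
    rw [← map_mul, mul_inv_cancel, map_one]
    rfl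
  have hadd : ∀ a b, L (a + b) = L a * L (act (L a)⁻¹ b) := fun a b => by rw [← hL, hact]
  have hcongr : ∀ a a' b b', L a = L a' → L b = L b' → L (a + b) = L (a' + b') := by
    intro a a' b b' h h'
    calc L (a + b) = L (a' + b) := by rw [hadd, hadd, h]
      _ = L (b + a') := by rw [add_comm]
      _ = L (b' + a') := by rw [hadd, hadd, h']
      _ = L (a' + b') := by rw [add_comm]
  have h0 : L 0 = 1 := by
    have := hL 0 0
    rw [map_zero, add_zero] at this
    exact left_eq_mul.mp this
  obtain ⟨s, hs⟩ := hsurj.hasRightInverse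
  let iA : Add G := ⟨fun g h => L (s g + s h)⟩
  let iZ : Zero G := ⟨L 0⟩
  let iN : Neg G := ⟨fun g => L (act g (s g⁻¹))⟩
  have hLadd : ∀ a b, L (a + b) = L a + L b := fun a b => hcongr _ _ _ _ (hs _).symm (hs _).symm
  let iG : AddCommGroup G :=
    { AddGroup.ofLeftAxioms (G := G)
        (fun a b c => by
          obtain ⟨a, rfl⟩ := hsurj a
          obtain ⟨b, rfl⟩ := hsurj b
          obtain ⟨c, rfl⟩ := hsurj c
          rw [← hLadd, ← hLadd, ← hLadd, ← hLadd, add_assoc])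
        (fun a => by
          obtain ⟨a, rfl⟩ := hsurj a
          change L 0 + L a = L a
          rw [← hLadd, zero_add])
        (fun a => by
          obtain ⟨a, rfl⟩ := hsurj a
          change L (act (L a) (s (L a)⁻¹)) + L a = L 0
          rw [← hLadd, add_comm, hL, hs, mul_inv_cancel, h0]) with
      add_comm := fun a b => by
        obtain ⟨a, rfl⟩ := hsurj a
        obtain ⟨b, rfl⟩ := hsurj b
        rw [← hLadd, ← hLadd, add_comm] }
  have hmul : ∀ a b, L a * L b = L a + L (act (L a) b) := fun a b => by rw [← hL, hLadd]
  have iB : IsLeftBrace G := ⟨fun a b c => by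
    obtain ⟨a, rfl⟩ := hsurj a
    obtain ⟨b, rfl⟩ := hsurj b
    obtain ⟨c, rfl⟩ := hsurj c
    rw [← hLadd, hmul, hmul, hmul, map_add, hLadd]
    abel⟩
  refine ⟨iG, iB, hLadd, fun g b => ?_⟩
  obtain ⟨a, rfl⟩ := hsurj g
  rw [lam_apply, hmul, neg_add_cancel_left]

end Transport

section Socle

variable (B : Type*) [Group B] [AddCommGroup B] [IsLeftBrace B]

/-- The socle of a brace, the kernel of the lambda map. -/
abbrev soc : Subgroup B := (lam (B := B)).ker

variable {B}

theorem mem_soc {a : B} : a ∈ soc B ↔ lam a = 1 := MonoidHom.mem_ker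

theorem mul_eq_add_of_mem_soc {a : B} (ha : a ∈ soc B) (b : B) : a * b = a + b := by
  rw [mul_eq, mem_soc.mp ha]
  rfl

theorem mem_soc_iff {a : B} : a ∈ soc B ↔ ∀ b, lam a b = b :=
  mem_soc.trans ⟨fun h b => by rw [h]; rfl, fun h => AddMonoidHom.ext h⟩

/-- The lambda action of the quotient by the socle. -/
theorem exists_quotient (B : Type*) [Group B] [AddCommGroup B] [IsLeftBrace B] :
    ∃ (_ : AddCommGroup (B ⧸ soc B)) (_ : IsLeftBrace (B ⧸ soc B)),
      (∀ a b : B, ((a + b : B) : B ⧸ soc B) = (a : B ⧸ soc B) + b) ∧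
      ∀ g b : B, lam (g : B ⧸ soc B) (b : B ⧸ soc B) = ((lam g b : B) : B ⧸ soc B) := by
  obtain ⟨i, j, h1, h2⟩ := exists_of_surjective (M := B) (G := B ⧸ soc B)
    (QuotientGroup.lift (soc B) lam fun _ h => h)
    (QuotientGroup.mk' (soc B)) (QuotientGroup.mk'_surjective _)
    (fun a b => by
      rw [← map_mul, mul_eq]; rfl)
  refine ⟨i, j, h1, fun g b => ?_⟩
  exact h2 (QuotientGroup.mk' (soc B) g) b

theorem Generates.of_surjective {C : Type*} [Group C] [AddCommGroup C] [IsLeftBrace C] {e : B}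
    (he : Generates e) (f : B →+ C) (hf : Function.Surjective f)
    (h : ∀ g, ∃ c, lam c (f e) = f (lam g e)) : Generates (f e) := fun A hA => by
  have htop := he (A.comap f) fun g => by
    obtain ⟨c, hc⟩ := h g
    rw [AddSubgroup.mem_comap, ← hc]
    exact hA c
  rw [eq_top_iff]
  intro y _
  obtain ⟨y, rfl⟩ := hf y
  exact (htop ▸ AddSubgroup.mem_top y : y ∈ A.comap f)

end Socle

section Solvable

variable (B : Type*) [Group B] [AddCommGroup B] [IsLeftBrace B] [Finite B]

theorem isSolvable : Group.IsSolvable B := by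
  refine isSolvable_of_hall fun p hp => ?_
  obtain ⟨k, m, hm, hB⟩ := Nat.exists_eq_pow_mul_and_not_dvd (n := Nat.card B)
    Nat.card_pos.ne' p hp.ne_one
  have hpm : m.Coprime (p ^ k) := ((hp.coprime_iff_not_dvd.mpr hm).pow_left k).symm
  have hpm' : m.Coprime p := (hp.coprime_iff_not_dvd.mpr hm).symm
  have hT : Nat.card (tors B m) = m := card_tors hpm (by rw [hB, mul_comm])
  refine ⟨tors B m, by rwa [hT], k, ?_⟩
  have h := (tors B m).card_mul_index
  have hpos : 0 < m := hT ▸ Nat.card_pos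
  rw [hT, hB, mul_comm (p ^ k)] at h
  exact Nat.eq_of_mul_eq_mul_left hpos h

end Solvable

/-- A normal subgroup of order prime to `m` centralizes `tors B m` under the lambda action. -/
theorem lam_eq_of_mem_normal {B : Type*} [Group B] [AddCommGroup B] [IsLeftBrace B]
    {n m : ℕ} (hnm : n.Coprime m) {M : Subgroup B} [M.Normal] (hM : M ≤ tors B n)
    {a c : B} (ha : a ∈ M) (hc : c ∈ tors B m) : lam a c = c := by
  have ha' : c⁻¹ * a * c ∈ M := by
    simpa using Subgroup.Normal.conj_mem inferInstance a ha c⁻¹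
  have h1 : c + lam c (c⁻¹ * a * c) = a + lam a c := by
    rw [← mul_eq, ← mul_eq]
    group
  have h2 : c - lam a c = a - lam c (c⁻¹ * a * c) := by
    rw [sub_eq_sub_iff_add_eq_add, h1]
  have h3 := eq_zero_of_mem_tors hnm
    (h2 ▸ sub_mem_tors (hM ha) (lam_mem_tors _ (hM ha'))) (sub_mem_tors hc (lam_mem_tors a hc))
  exact (sub_eq_zero.mp h3).symm

/-- A subbrace containing a generator of square-free orbit is everything. -/
def SubbraceProp (B : Type*) [Group B] [AddCommGroup B] [IsLeftBrace B] : Prop :=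
  ∀ e : B, Generates e → Squarefree (stab e).index → ∀ F : AddSubgroup B, e ∈ F →
    (∀ a ∈ F, ∀ b ∈ F, lam a b ∈ F) → F = ⊤

section Action

variable {B : Type*} [Group B] [AddCommGroup B] [IsLeftBrace B] [Finite B]

theorem le_tors_of_normal {q k m : ℕ} (hq : q.Prime) (hm : ¬ q ∣ m)
    (hB : Nat.card B = q ^ k * m) (M : Subgroup B) [M.Normal] (hM : IsPGroup q M) :
    M ≤ tors B (q ^ k) := by
  have : Fact q.Prime := ⟨hq⟩
  have hcop : (q ^ k).Coprime m := (hq.coprime_iff_not_dvd.mpr hm).pow_left k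
  have hP := card_tors hcop hB
  have hidx : (tors B (q ^ k)).index = m := by
    have h := (tors B (q ^ k)).card_mul_index
    rw [hP, hB] at h
    exact Nat.eq_of_mul_eq_mul_left (Nat.pos_of_ne_zero (pow_ne_zero _ hq.ne_zero)) h
  rw [← Subgroup.relIndex_eq_one]
  obtain ⟨j, hj⟩ := IsPGroup.iff_card.mp hM
  have h1 : (tors B (q ^ k)).relIndex M ∣ m :=
    hidx ▸ Subgroup.relIndex_dvd_index_of_normal_right _ _
  have h2 : (tors B (q ^ k)).relIndex M ∣ q ^ j := hj ▸ Subgroup.relIndex_dvd_card _ _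
  exact Nat.eq_one_of_dvd_coprimes ((hq.coprime_iff_not_dvd.mpr hm).pow_left j) h2 h1

theorem lam_eq_of_mem_tors {q k m : ℕ} (hq : q.Prime) (hm : ¬ q ∣ m)
    (hB : Nat.card B = q ^ k * m) {e : B} (he : Generates e) (hsq : Squarefree (stab e).index)
    (M : Subgroup B) [M.Normal] (hMbot : M ≠ ⊥) (hMq : IsPGroup q M) (hsoc : soc B = ⊥)
    (ih : SubbraceProp (tors B m)) {a c : B} (ha : a ∈ tors B (q ^ k)) (hc : c ∈ tors B m) :
    lam a c = c := by
  have : Fact q.Prime := ⟨hq⟩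
  have hcop : (q ^ k).Coprime m := (hq.coprime_iff_not_dvd.mpr hm).pow_left k
  have hMP : M ≤ tors B (q ^ k) := le_tors_of_normal hq hm hB M hMq
  obtain ⟨z, hz0, hz1⟩ := Nat.chineseRemainder hcop 0 1
  have hzmem : ∀ b : B, z • b ∈ tors B m := fun b => by
    obtain ⟨w, rfl⟩ := (Nat.modEq_zero_iff_dvd.mp hz0)
    rw [mem_tors, ← mul_smul, show m * (q ^ k * w) = w * (q ^ k * m) by ring, mul_smul, ← hB,
      card_nsmul_eq_zero', smul_zero]
  have hzid : ∀ b ∈ tors B m, z • b = b := fun b hb => by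
    have h : z • b = 1 • b := by
      rw [nsmul_eq_nsmul_iff_modEq]
      exact hz1.of_dvd (addOrderOf_dvd_of_nsmul_eq_zero hb)
    rw [h, one_smul]
  set S := stab e with hS
  set S' := stab (z • e) with hS'
  have hSS' : S ≤ S' := stab_le_stab_nsmul z e
  have hMS' : M ≤ S' := fun x hx => lam_eq_of_mem_normal hcop hMP hx (hzmem e)
  have hSM : q ∣ S.relIndex M := by
    obtain ⟨j, hj⟩ := IsPGroup.iff_card.mp hMq
    obtain ⟨i, -, hi⟩ := (Nat.dvd_prime_pow hq).mp (hj ▸ S.relIndex_dvd_card M)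
    rcases i with _ | i
    · exfalso
      rw [pow_zero, Subgroup.relIndex_eq_one] at hi
      apply hMbot
      rw [eq_bot_iff, ← hsoc]
      intro x hx
      refine mem_soc.mpr (he.lam_eq_one fun g => hi ?_)
      simpa using Subgroup.Normal.conj_mem inferInstance x hx g⁻¹
    · rw [hi, pow_succ]
      exact Dvd.intro_left _ rfl
  have hmul := Subgroup.relIndex_mul_index hSS'
  have hqS' : ¬ q ∣ S'.index := fun h => by
    have h1 : q * q ∣ S.index := by
      rw [← hmul]
      exact mul_dvd_mul (hSM.trans (Subgroup.relIndex_dvd_relIndex_of_normal hSS' hMS')) h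
    exact hq.ne_one (Nat.isUnit_iff.mp (hsq q h1))
  have hPq : IsPGroup q (tors B (q ^ k)) := IsPGroup.of_card (card_tors hcop hB)
  obtain ⟨x, hx⟩ := hPq.nonempty_fixed_point_of_prime_not_dvd_card (B ⧸ S') hqS'
  obtain ⟨g₀, rfl⟩ := QuotientGroup.mk_surjective x
  set w : B := lam g₀ (z • e) with hw
  have hwQ : w ∈ tors B m := lam_mem_tors _ (hzmem e)
  have hwP : ∀ g ∈ tors B (q ^ k), lam g w = w := fun g hg => by
    have h := hx ⟨g, hg⟩
    have h' : ((g * g₀ : B) : B ⧸ S') = (g₀ : B) := h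
    have h2 : lam (g₀⁻¹ * (g * g₀)) (z • e) = z • e := QuotientGroup.eq.mp h'.symm
    rw [lam_mul_apply, lam_mul_apply] at h2
    rw [hw, ← lam_lam_inv g₀ (lam g _), h2]
  have horbit : ∀ b : B, ∃ c ∈ tors B m, lam b (z • e) = lam c w := fun b => by
    obtain ⟨c, hc, a, ha, h⟩ := exists_mul_of_coprime hcop hB (b * g₀⁻¹)
    refine ⟨c, hc, ?_⟩
    rw [← hwP a ha, ← lam_mul_apply, ← h, hw, ← lam_mul_apply, inv_mul_cancel_right]
  let v : tors B m := ⟨w, hwQ⟩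
  have hgen : Generates v := fun A hA => by
    let π : B →+ tors B m :=
      { toFun := fun b => ⟨z • b, hzmem b⟩
        map_zero' := Subtype.ext (smul_zero z)
        map_add' := fun b c => Subtype.ext (smul_add z b c) }
    have htop := he (A.comap π) fun g => by
      obtain ⟨c, hc, h⟩ := horbit g
      have h' : π (lam g e) = lam ⟨c, hc⟩ v := Subtype.ext (by
        change z • lam g e = lam c w
        rw [← h, map_nsmul])
      rw [AddSubgroup.mem_comap, h']
      exact hA _
    rw [eq_top_iff]
    intro y _
    have hy : (y : B) ∈ A.comap π := htop ▸ AddSubgroup.mem_top _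
    have hy' : π y = y := Subtype.ext (hzid y y.2)
    rwa [AddSubgroup.mem_comap, hy'] at hy
  have hidx : (stab v).index = S'.index := by
    rw [index_stab, hS', index_stab, ← Nat.card_image_of_injective Subtype.val_injective]
    congr 2
    ext y
    constructor
    · rintro ⟨_, ⟨g, rfl⟩, rfl⟩
      exact ⟨(g : B) * g₀, lam_mul_apply _ _ _⟩
    · rintro ⟨g, rfl⟩
      obtain ⟨c, hc, h⟩ := horbit g
      exact ⟨lam (⟨c, hc⟩ : tors B m) v, ⟨⟨c, hc⟩, rfl⟩, h.symm⟩
  let F : AddSubgroup (tors B m) :=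
    { carrier := {c | ∀ g ∈ tors B (q ^ k), lam g (c : B) = c}
      zero_mem' := fun g _ => map_zero (lam g)
      add_mem' := fun {c d} hc hd g hg => by
        rw [coe_add_tors, map_add, hc g hg, hd g hg]
      neg_mem' := fun {c} hc g hg => by
        rw [coe_neg_tors, map_neg, hc g hg] }
  have hF : F = ⊤ := by
    refine ih v hgen (hidx ▸ hsq.squarefree_of_dvd (hmul ▸ Dvd.intro_left _ rfl)) F hwP ?_
    intro c hc d hd g hg
    have h : g * c = c * lam (c : B)⁻¹ g := by
      rw [mul_eq, hc g hg, add_comm, add_eq]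
    rw [coe_lam_tors, ← lam_mul_apply, h, lam_mul_apply, hd _ (lam_mem_tors _ hg)]
  have hcF : (⟨c, hc⟩ : tors B m) ∈ F := hF ▸ AddSubgroup.mem_top _
  exact hcF a ha

end Action

end IsLeftBrace

/-- In a `q`-group, a subgroup of index dividing `q` contains all commutators. -/
theorem Subgroup.commutator_mem_of_index_dvd_prime {G : Type*} [Group G] [Finite G] {q k : ℕ}
    (hq : q.Prime) (hG : Nat.card G = q ^ k) {N : Subgroup G} (hN : N.index ∣ q) (a b : G) :
    a * b * a⁻¹ * b⁻¹ ∈ N := by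
  have hnormal : N.Normal := by
    rcases (Nat.dvd_prime hq).mp hN with h | h
    · exact normal_of_index_eq_one h
    · apply normal_of_index_eq_minFac_card
      have hk : k ≠ 0 := by
        rintro rfl
        have := h ▸ hG ▸ N.index_dvd_card
        exact hq.one_lt.ne' (Nat.dvd_one.mp (by simpa using this))
      rw [h, hG, hq.pow_minFac hk]
  have : Fact q.Prime := ⟨hq⟩
  have hcyc : IsCyclic (G ⧸ N) := isCyclic_of_card_dvd_prime (p := q) hN
  let _ : CommGroup (G ⧸ N) := IsCyclic.commGroup
  rw [← QuotientGroup.eq_one_iff]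
  change (a : G ⧸ N) * b * (a : G ⧸ N)⁻¹ * (b : G ⧸ N)⁻¹ = 1
  rw [mul_comm (a : G ⧸ N) b]
  group

namespace IsLeftBrace

section Action

variable {B : Type*} [Group B] [AddCommGroup B] [IsLeftBrace B] [Finite B]

theorem soc_ne_bot_of_lam_eq {q k m : ℕ} (hq : q.Prime) (hm : ¬ q ∣ m)
    (hB : Nat.card B = q ^ k * m) {e : B} (he : Generates e) (hsq : Squarefree (stab e).index)
    (hk : tors B (q ^ k) ≠ ⊥)
    (hact : ∀ a ∈ tors B (q ^ k), ∀ c ∈ tors B m, lam a c = c) : soc B ≠ ⊥ := by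
  intro hsoc
  have : Fact q.Prime := ⟨hq⟩
  have hcop : (q ^ k).Coprime m := (hq.coprime_iff_not_dvd.mpr hm).pow_left k
  have hP : Nat.card (tors B (q ^ k)) = q ^ k := card_tors hcop hB
  set P := tors B (q ^ k) with hPdef
  have hconj : ∀ a ∈ P, ∀ c ∈ tors B m, c⁻¹ * a * c = lam c⁻¹ a := fun a ha c hc => by
    rw [mul_assoc, mul_eq a c, hact a ha c hc, add_comm, add_eq, inv_mul_cancel_left]
  have hnormal : P.Normal := ⟨fun a ha g => by
    obtain ⟨c, hc, b, hb, rfl⟩ := exists_mul_of_coprime hcop hB g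
    have h1 : b * a * b⁻¹ ∈ P := P.mul_mem (P.mul_mem hb ha) (P.inv_mem hb)
    have h2 := hconj _ h1 c⁻¹ (inv_mem hc)
    rw [show c * b * a * (c * b)⁻¹ = c⁻¹⁻¹ * (b * a * b⁻¹) * c⁻¹ by group, h2]
    exact lam_mem_tors _ h1⟩
  have hidx : ((stab e).subgroupOf P).index ∣ q := by
    obtain ⟨i, -, hi⟩ := (Nat.dvd_prime_pow hq).mp (hP ▸ (stab e).relIndex_dvd_card P)
    have h := hsq.squarefree_of_dvd (Subgroup.relIndex_dvd_index_of_normal_right (stab e) P)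
    change (stab e).relIndex P ∣ q
    rw [hi] at h ⊢
    rcases i with _ | i
    · simp
    · rcases i with _ | i
      · simp
      · exact absurd (Nat.isUnit_iff.mp (h q ⟨q ^ i, by ring⟩)) hq.ne_one
  have hcomm : ∀ a ∈ P, ∀ b ∈ P, a * b = b * a := fun a ha b hb => by
    have h : a * b * a⁻¹ * b⁻¹ ∈ soc B := mem_soc.mpr (he.lam_eq_one fun g => by
      have hc : ∀ x ∈ P, g⁻¹ * x * g ∈ P := fun x hx => by
        simpa using hnormal.conj_mem x hx g⁻¹
      have := Subgroup.commutator_mem_of_index_dvd_prime hq hP hidx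
        (⟨_, hc a ha⟩ : P) ⟨_, hc b hb⟩
      rw [Subgroup.mem_subgroupOf] at this
      convert! this using 1
      simp only [Subgroup.coe_mul, Subgroup.coe_inv]
      group)
    rw [hsoc, Subgroup.mem_bot, mul_inv_eq_one, mul_inv_eq_iff_eq_mul] at h
    exact h
  let _ : MulAction P P :=
    { smul := fun g b => lam g b
      one_smul := lam_one_apply
      mul_smul := lam_mul_apply }
  have hPq : IsPGroup q P := IsPGroup.of_card hP
  have hdvd : q ∣ Nat.card P := by
    rcases hPq.card_eq_or_dvd with h | h
    · exact absurd ((Subgroup.eq_bot_iff_card P).mpr h) hk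
    · exact h
  obtain ⟨a, ha, ha0⟩ := hPq.exists_fixed_point_of_prime_dvd_card_of_fixed_point P hdvd
    (a := (0 : tors B (q ^ k))) (fun g => map_zero (lam g))
  have hfix : ∀ g ∈ P, lam g (a : B) = a := fun g hg => congrArg Subtype.val (ha ⟨g, hg⟩)
  have hsoca : (a : B) ∈ soc B := mem_soc_iff.mpr fun b => by
    obtain ⟨c, hc, g, hg, rfl⟩ := exists_add_of_coprime hcop hB b
    have h1 : lam (a : B) g = g := by
      have h := hcomm a a.2 g hg
      rw [mul_eq, mul_eq g, hfix g hg, add_comm g] at h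
      exact add_left_cancel h
    rw [map_add, hact a a.2 c hc, h1]
  rw [hsoc, Subgroup.mem_bot, one_eq_zero] at hsoca
  exact ha0 (Subtype.ext hsoca.symm)

theorem card_tors_lt {B : Type*} [Group B] [AddCommGroup B] [IsLeftBrace B] [Finite B]
    {q k m : ℕ} (hq : q.Prime) (hm : ¬ q ∣ m)
    (hB : Nat.card B = q ^ k * m) (hk : k ≠ 0) : Nat.card (tors B m) < Nat.card B := by
  have hcop : (q ^ k).Coprime m := (hq.coprime_iff_not_dvd.mpr hm).pow_left k
  rw [card_tors hcop.symm (by rw [hB, mul_comm]), hB]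
  have hpos : 0 < m := Nat.pos_of_ne_zero fun h => hm (h ▸ dvd_zero q)
  exact lt_mul_of_one_lt_left hpos (Nat.one_lt_pow hk hq.one_lt)

end Action

theorem soc_ne_bot_of_forall_lt {B : Type u} [Group B] [AddCommGroup B] [IsLeftBrace B] [Finite B]
    [Nontrivial B]
    (ih : ∀ (C : Type u) [Group C] [AddCommGroup C] [IsLeftBrace C] [Finite C],
      Nat.card C < Nat.card B → SubbraceProp C)
    {e : B} (he : Generates e) (hsq : Squarefree (stab e).index) : soc B ≠ ⊥ := by
  intro hsoc
  have := isSolvable B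
  obtain ⟨q, hq, M, hM, hMbot, hMq⟩ := exists_normal_isPGroup (G := B)
  obtain ⟨k, m, hm, hB⟩ := Nat.exists_eq_pow_mul_and_not_dvd (n := Nat.card B)
    Nat.card_pos.ne' q hq.ne_one
  have hMP : M ≤ tors B (q ^ k) := le_tors_of_normal hq hm hB M hMq
  have hk : k ≠ 0 := by
    rintro rfl
    refine hMbot (eq_bot_iff.mpr fun x hx => ?_)
    have h : (q ^ 0) • x = 0 := hMP hx
    rw [pow_zero, one_smul] at h
    rw [Subgroup.mem_bot, h, one_eq_zero]
  refine soc_ne_bot_of_lam_eq hq hm hB he hsq (fun h => hMbot (le_bot_iff.mp (h ▸ hMP))) ?_ hsoc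
  intro a ha c hc
  exact lam_eq_of_mem_tors hq hm hB he hsq M hMbot hMq hsoc
    (ih _ (card_tors_lt hq hm hB hk)) ha hc

theorem subbraceProp (B : Type u) [Group B] [AddCommGroup B] [IsLeftBrace B] [Finite B] :
    SubbraceProp B := by
  induction hn : Nat.card B using Nat.strong_induction_on generalizing B with
  | _ n ih =>
  subst hn
  intro e he hsq F heF hF
  cases subsingleton_or_nontrivial B with
  | inl h => exact Subsingleton.elim _ _
  | inr h =>
  have hsoc : soc B ≠ ⊥ := soc_ne_bot_of_forall_lt (fun C _ _ _ _ h => ih _ h C rfl) he hsq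
  obtain ⟨_, _, hadd, hlam⟩ := exists_quotient B
  let π : B →+ B ⧸ soc B := AddMonoidHom.mk' (fun b => (b : B ⧸ soc B)) hadd
  have hcard : Nat.card (B ⧸ soc B) < Nat.card B := by
    rw [(soc B).card_eq_card_quotient_mul_card_subgroup]
    exact lt_mul_of_one_lt_right Nat.card_pos ((soc B).one_lt_card_iff_ne_bot.mpr hsoc)
  have hgen : Generates (e : B ⧸ soc B) :=
    he.of_surjective π QuotientGroup.mk_surjective fun g => ⟨g, hlam g e⟩
  have hidx : (stab (e : B ⧸ soc B)).index ∣ (stab e).index := by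
    rw [← Subgroup.index_comap_of_surjective _ (QuotientGroup.mk'_surjective (soc B))]
    apply Subgroup.index_dvd_of_le
    intro g hg
    rw [Subgroup.mem_comap, mem_stab]
    change lam (g : B ⧸ soc B) (e : B ⧸ soc B) = e
    rw [hlam, mem_stab.mp hg]
  have htop : F.map π = ⊤ := by
    refine ih _ hcard (B ⧸ soc B) rfl _ hgen (hsq.squarefree_of_dvd hidx) _ ⟨e, heF, rfl⟩ ?_
    rintro _ ⟨a, ha, rfl⟩ _ ⟨b, hb, rfl⟩
    exact ⟨lam a b, hF a ha b hb, (hlam a b).symm⟩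
  refine he F fun b => ?_
  obtain ⟨f, hf, hfb⟩ : (b : B ⧸ soc B) ∈ F.map π := htop ▸ AddSubgroup.mem_top _
  have h : f⁻¹ * b ∈ soc B := QuotientGroup.eq.mp hfb
  have h2 := mem_soc_iff.mp h e
  rw [lam_mul_apply] at h2
  rw [← lam_lam_inv f (lam b e), h2]
  exact hF f hf e heF

theorem soc_ne_bot {B : Type u} [Group B] [AddCommGroup B] [IsLeftBrace B] [Finite B]
    [Nontrivial B] {e : B} (he : Generates e) (hsq : Squarefree (stab e).index) : soc B ≠ ⊥ :=
  soc_ne_bot_of_forall_lt (fun C _ _ _ _ _ => subbraceProp C) he hsq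

end IsLeftBrace

theorem IsPGroup.eq_one_of_pow_eq_one {G : Type*} [Group G] {q n : ℕ} {R : Subgroup G}
    (hR : IsPGroup q R) (hq : q.Prime) (hn : ¬ q ∣ n) {x : G} (hx : x ∈ R) (hxn : x ^ n = 1) :
    x = 1 := by
  obtain ⟨k, hk⟩ := isPGroup_iff_pow_pow_eq_one.mp hR ⟨x, hx⟩
  have hk' : x ^ q ^ k = 1 := congrArg Subtype.val hk
  rw [← orderOf_eq_one_iff]
  exact Nat.eq_one_of_dvd_coprimes ((hq.coprime_iff_not_dvd.mpr hn).pow_left k)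
    (orderOf_dvd_of_pow_eq_one hk') (orderOf_dvd_of_pow_eq_one hxn)

theorem IsPGroup.pow_prime_eq_one_of_squarefree {G : Type*} [Group G] {q n : ℕ} {R : Subgroup G}
    (hR : IsPGroup q R) (hq : q.Prime) (hn : Squarefree n) {x : G} (hx : x ∈ R)
    (hxn : x ^ n = 1) : x ^ q = 1 := by
  obtain ⟨k, hk⟩ := isPGroup_iff_pow_pow_eq_one.mp hR ⟨x, hx⟩
  have hk' : x ^ q ^ k = 1 := congrArg Subtype.val hk
  obtain ⟨i, -, hi⟩ := (Nat.dvd_prime_pow hq).mp (orderOf_dvd_of_pow_eq_one hk')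
  have h := hn.squarefree_of_dvd (orderOf_dvd_of_pow_eq_one hxn)
  rw [← orderOf_dvd_iff_pow_eq_one, hi]
  rw [hi] at h
  rcases i with _ | _ | i
  · simp
  · simp
  · exact absurd (Nat.isUnit_iff.mp (h q ⟨q ^ i, by ring⟩)) hq.ne_one

namespace IsLeftBrace

/-- In the socle, elements are killed by the relative index of a core-free subgroup. -/
theorem pow_relIndex_eq_one {B : Type*} [Group B] [AddCommGroup B] [IsLeftBrace B]
    {S : Subgroup B} (hcore : ∀ x, (∀ g : B, g⁻¹ * x * g ∈ S) → x = 1) {a : B} (ha : a ∈ soc B) :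
    a ^ S.relIndex (soc B) = 1 := by
  have hcomm : ∀ a b : soc B, a * b = b * a := fun a b => Subtype.ext (by
    rw [Subgroup.coe_mul, Subgroup.coe_mul, mul_eq_add_of_mem_soc a.2, mul_eq_add_of_mem_soc b.2,
      add_comm])
  have hnormal : (S.subgroupOf (soc B)).Normal := ⟨fun x hx g => by
    rwa [hcomm g x, mul_inv_cancel_right]⟩
  refine hcore _ fun g => ?_
  have hg : g⁻¹ * a * g ∈ soc B := by
    simpa using Subgroup.Normal.conj_mem inferInstance a ha g⁻¹
  have h := (S.subgroupOf (soc B)).pow_index_mem (⟨_, hg⟩ : soc B)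
  rw [Subgroup.mem_subgroupOf] at h
  have h2 := conj_pow (a := g⁻¹) (b := a) (i := S.relIndex (soc B))
  rw [inv_inv] at h2
  rw [← h2]
  exact h

theorem prime_dvd_index_and_isPGroup {B : Type u} [Group B] [AddCommGroup B] [IsLeftBrace B]
    [Finite B] {e : B} (he : Generates e) {S : Subgroup B} (hS : S ≤ stab e)
    (hsq : Squarefree S.index) (hcore : ∀ x, (∀ g : B, g⁻¹ * x * g ∈ S) → x = 1)
    {q : ℕ} (hq : q.Prime) :
    (q ∣ Nat.card B → q ∣ S.index) ∧ ∀ R : Subgroup B, IsPGroup q R →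
      (∀ a ∈ R, ∀ b ∈ R, a * b = b * a) ∧ ∀ a ∈ R, a ^ q = 1 := by
  induction hn : Nat.card B using Nat.strong_induction_on generalizing B with
  | _ n ih =>
  subst hn
  cases subsingleton_or_nontrivial B with
  | inl h =>
    refine ⟨fun h => ?_, fun R _ => ⟨fun a _ b _ => Subsingleton.elim _ _,
      fun a _ => Subsingleton.elim _ _⟩⟩
    rw [Nat.card_of_subsingleton (1 : B)] at h
    exact absurd (Nat.dvd_one.mp h) hq.ne_one
  | inr h =>
  have hmul := Subgroup.relIndex_mul_index hS
  have hsoc : soc B ≠ ⊥ := soc_ne_bot he (hsq.squarefree_of_dvd (hmul ▸ Dvd.intro_left _ rfl))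
  obtain ⟨_, _, hadd, hlam⟩ := exists_quotient B
  let π : B →+ B ⧸ soc B := AddMonoidHom.mk' (fun b => (b : B ⧸ soc B)) hadd
  have hcard := (soc B).card_eq_card_quotient_mul_card_subgroup
  have hlt : Nat.card (B ⧸ soc B) < Nat.card B := by
    rw [hcard]
    exact lt_mul_of_one_lt_right Nat.card_pos ((soc B).one_lt_card_iff_ne_bot.mpr hsoc)
  have hgen : Generates (e : B ⧸ soc B) :=
    he.of_surjective π QuotientGroup.mk_surjective fun g => ⟨g, hlam g e⟩
  have hle : soc B ≤ stab e := fun x hx => mem_soc_iff.mp hx e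
  have hker : (QuotientGroup.mk' (soc B)).ker ≤ stab e := by rwa [QuotientGroup.ker_mk']
  have hidx : ((stab e).map (QuotientGroup.mk' (soc B))).index = (stab e).index :=
    Subgroup.index_map_eq _ (QuotientGroup.mk'_surjective _) hker
  obtain ⟨ih1, ih2⟩ := ih _ hlt hgen (S := (stab e).map (QuotientGroup.mk' (soc B)))
    (by
      rintro _ ⟨g, hg, rfl⟩
      rw [mem_stab]
      exact (hlam g e).trans (congrArg _ hg))
    (hidx ▸ hsq.squarefree_of_dvd (hmul ▸ Dvd.intro_left _ rfl))
    (fun x hx => by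
      obtain ⟨x, rfl⟩ := QuotientGroup.mk_surjective x
      refine (QuotientGroup.eq_one_iff x).mpr (mem_soc.mpr (he.lam_eq_one fun g => ?_))
      have h := hx (g : B ⧸ soc B)
      change QuotientGroup.mk' (soc B) (g⁻¹ * x * g) ∈ _ at h
      rw [← Subgroup.mem_comap, Subgroup.comap_map_eq_self hker] at h
      exact h)
    rfl
  rw [hidx] at ih1
  have hrel := Subgroup.relIndex_dvd_relIndex_of_normal hS hle
  have hdvd : q ∣ Nat.card (soc B) → q ∣ S.relIndex (stab e) := fun h => by
    have : Fact q.Prime := ⟨hq⟩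
    obtain ⟨x, hx⟩ := exists_prime_orderOf_dvd_card' (G := soc B) q h
    refine dvd_trans ?_ hrel
    rw [← hx, ← Subgroup.orderOf_coe]
    exact orderOf_dvd_of_pow_eq_one (pow_relIndex_eq_one hcore x.2)
  refine ⟨fun h => ?_, fun R hR => ?_⟩
  · rw [← hmul]
    rcases hq.dvd_mul.mp (hcard ▸ h) with h | h
    · exact (ih1 h).mul_left _
    · exact (hdvd h).mul_right _
  by_cases hqK : q ∣ Nat.card (soc B)
  · have hqB : ¬ q ∣ Nat.card (B ⧸ soc B) := fun h => by
      have h1 : q * q ∣ S.index := hmul ▸ mul_dvd_mul (hdvd hqK) (ih1 h)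
      exact hq.ne_one (Nat.isUnit_iff.mp (hsq q h1))
    have hRK : ∀ a ∈ R, a ∈ soc B := fun a ha =>
      (QuotientGroup.eq_one_iff a).mp ((hR.map (QuotientGroup.mk' (soc B))).eq_one_of_pow_eq_one
        hq hqB ⟨a, ha, rfl⟩ pow_card_eq_one')
    refine ⟨fun a ha b hb => ?_, fun a ha => ?_⟩
    · rw [mul_eq_add_of_mem_soc (hRK a ha), mul_eq_add_of_mem_soc (hRK b hb), add_comm]
    · refine hR.pow_prime_eq_one_of_squarefree hq ?_ ha (pow_relIndex_eq_one hcore (hRK a ha))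
      exact hsq.squarefree_of_dvd (hrel.trans (hmul ▸ Dvd.intro _ rfl))
  · obtain ⟨h1, h2⟩ := ih2 _ (hR.map (QuotientGroup.mk' (soc B)))
    have hRK : ∀ x ∈ R, (x : B ⧸ soc B) = 1 → x = 1 := fun x hx hx1 =>
      hR.eq_one_of_pow_eq_one hq hqK hx (congrArg Subtype.val
        (pow_card_eq_one' (x := (⟨x, (QuotientGroup.eq_one_iff x).mp hx1⟩ : soc B))))
    refine ⟨fun a ha b hb => ?_, fun a ha => ?_⟩
    · refine mul_inv_eq_one.mp (hRK _ (mul_mem (mul_mem ha hb) (inv_mem (mul_mem hb ha))) ?_)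
      have := h1 a ⟨a, ha, rfl⟩ b ⟨b, hb, rfl⟩
      exact mul_inv_eq_one.mpr this
    · exact hRK _ (pow_mem ha q) (h2 a ⟨a, ha, rfl⟩)

end IsLeftBrace

namespace YBE

variable {X : Type u} (S : YBE X)

/-- Multiplying on the right by the `σ` of a translated point. -/
def step (g : ↥S.permGroup) (x : X) : ↥S.permGroup :=
  g * S.σg ((g : Equiv.Perm X)⁻¹ x)

instance : RightCommutative S.step where
  right_comm g x y := by
    have h := S.ybe ((g : Equiv.Perm X)⁻¹ x) ((g : Equiv.Perm X)⁻¹ y)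
    apply Subtype.ext
    simp only [step, σg, Subgroup.coe_mul, mul_inv_rev, Equiv.Perm.mul_apply, mul_assoc]
    rw [h]

/-- The map from the free commutative monoid on `X` to `𝒢(X,r)` sending a formal sum of points to
the corresponding sum in the natural brace. -/
def sumMap (s : Multiset X) : ↥S.permGroup :=
  s.foldl S.step 1

theorem foldl_step_map (g h : ↥S.permGroup) (s : Multiset X) :
    (s.map (g : Equiv.Perm X)).foldl S.step (g * h) = g * s.foldl S.step h := by
  induction s using Multiset.induction_on generalizing h with
  | empty => rfl
  | cons x s ih =>
    rw [Multiset.map_cons, Multiset.foldl_cons, Multiset.foldl_cons, ← ih]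
    congr 1
    simp [step, mul_assoc]

theorem sumMap_singleton (x : X) : S.sumMap {x} = S.σg x := by
  rw [sumMap, ← Multiset.cons_zero, Multiset.foldl_cons, Multiset.foldl_zero]
  simp [step]

/-- The action of `𝒢(X,r)` on formal sums of points. -/
def multisetAct : ↥S.permGroup →* AddMonoid.End (Multiset X) where
  toFun g := Multiset.mapAddMonoidHom (g : Equiv.Perm X)
  map_one' := by
    ext s : 1
    exact Multiset.map_id s
  map_mul' g h := by
    ext s : 1
    exact (Multiset.map_map (g : Equiv.Perm X) (h : Equiv.Perm X) s).symm

theorem sumMap_add_act (a b : Multiset X) :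
    S.sumMap (a + S.multisetAct (S.sumMap a) b) = S.sumMap a * S.sumMap b := by
  have h := S.foldl_step_map (S.sumMap a) 1 b
  rw [mul_one] at h
  rw [sumMap, Multiset.foldl_add]
  exact h

theorem sumMap_surjective [Finite X] : Function.Surjective S.sumMap := by
  let R : Submonoid ↥S.permGroup :=
    { carrier := Set.range S.sumMap
      one_mem' := ⟨0, rfl⟩
      mul_mem' := by
        rintro _ _ ⟨a, rfl⟩ ⟨b, rfl⟩
        exact ⟨_, S.sumMap_add_act a b⟩ }
  rintro ⟨g, hg⟩
  change ⟨g, hg⟩ ∈ R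
  induction hg using Subgroup.closure_induction with
  | mem x hx =>
    obtain ⟨x, rfl⟩ := hx
    exact ⟨{x}, S.sumMap_singleton x⟩
  | one => exact R.one_mem
  | mul x y hx hy hx' hy' => exact R.mul_mem hx' hy'
  | inv x hx hx' =>
    have h : (⟨x, hx⟩ : ↥S.permGroup)⁻¹ ∈ Submonoid.powers (⟨x, hx⟩ : ↥S.permGroup) := by
      rw [(isOfFinOrder_of_finite _).mem_powers_iff_mem_zpowers]
      exact inv_mem (Subgroup.mem_zpowers _)
    exact (Submonoid.powers_le.mpr hx') h

theorem prime_dvd_card_and_isPGroup [Finite X] [Nonempty X] (hind : S.Indecomposable)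
    (hsq : Squarefree (Nat.card X)) {q : ℕ} (hq : q.Prime) :
    (q ∣ Nat.card ↥S.permGroup → q ∣ Nat.card X) ∧ ∀ R : Subgroup ↥S.permGroup, IsPGroup q R →
      (∀ a ∈ R, ∀ b ∈ R, a * b = b * a) ∧ ∀ a ∈ R, a ^ q = 1 := by
  obtain ⟨_, _, hadd, hlam⟩ :=
    IsLeftBrace.exists_of_surjective S.multisetAct S.sumMap S.sumMap_surjective S.sumMap_add_act
  obtain ⟨x₀⟩ := ‹Nonempty X›
  have hlam' : ∀ (g : ↥S.permGroup) x,
      IsLeftBrace.lam g (S.sumMap {x}) = S.sumMap {(g : Equiv.Perm X) x} := fun g x => by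
    rw [hlam]
    rfl
  have hgen : IsLeftBrace.Generates (S.sumMap {x₀}) := fun A hA => by
    rw [eq_top_iff]
    intro g _
    obtain ⟨s, rfl⟩ := S.sumMap_surjective g
    induction s using Multiset.induction_on with
    | empty =>
      have h : S.sumMap 0 = 0 := by simpa using hadd 0 0
      exact h ▸ A.zero_mem
    | cons x s ih =>
      rw [← Multiset.singleton_add, hadd]
      obtain ⟨g, hg, rfl⟩ := hind x₀ x
      exact A.add_mem (hlam' ⟨g, hg⟩ x₀ ▸ hA _) (ih trivial)
  have hidx : (MulAction.stabilizer ↥S.permGroup x₀).index = Nat.card X := by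
    have htrans : MulAction.orbit ↥S.permGroup x₀ = Set.univ :=
      Set.eq_univ_of_forall fun y => by
        obtain ⟨g, hg, rfl⟩ := hind x₀ y
        exact ⟨⟨g, hg⟩, rfl⟩
    rw [MulAction.index_stabilizer, htrans, Set.ncard_univ]
  rw [← hidx] at hsq ⊢
  refine IsLeftBrace.prime_dvd_index_and_isPGroup hgen (fun g hg => ?_) hsq (fun x hx => ?_) hq
  · have h : (g : Equiv.Perm X) x₀ = x₀ := hg
    rw [IsLeftBrace.mem_stab, hlam', h]
  · apply Subtype.ext
    ext y
    obtain ⟨g, hg, rfl⟩ := hind x₀ y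
    have h : g⁻¹ ((x : Equiv.Perm X) (g x₀)) = x₀ := hx ⟨g, hg⟩
    exact (Equiv.Perm.inv_eq_iff_eq.mp h).trans rfl

end YBE

/-- For an indecomposable solution of square-free cardinality
`p 0 ⋯ p (n-1)`, the only primes dividing `|𝒢(X,r)|` are the `p i`, and all Sylow
`p i`-subgroups of `𝒢(X,r)` are elementary abelian. -/
theorem statement18 {n : ℕ} {X : Type u} (p : Fin n → ℕ)
    (hp : ∀ i, Nat.Prime (p i)) (hinj : Function.Injective p)
    (S : YBE X) (hcard : Nat.card X = Finset.univ.prod p)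
    (hind : S.Indecomposable) :
    (∀ q : ℕ, q.Prime → q ∣ Nat.card ↥S.permGroup → ∃ i, p i = q) ∧
    ∀ (i : Fin n) (Q : Sylow (p i) ↥S.permGroup),
      (∀ a ∈ (Q : Subgroup ↥S.permGroup), ∀ b ∈ (Q : Subgroup ↥S.permGroup),
        a * b = b * a) ∧
      ∀ a ∈ (Q : Subgroup ↥S.permGroup), a ^ (p i) = 1 := by
  have hsq : Squarefree (Nat.card X) := by
    rw [hcard]
    refine Finset.squarefree_prod_of_pairwise_isCoprime (fun i _ j _ hij => ?_)
      fun i _ => (hp i).squarefree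
    exact (Nat.coprime_iff_isRelPrime.mp ((Nat.coprime_primes (hp i) (hp j)).mpr (hinj.ne hij)))
  have hne : Nat.card X ≠ 0 := hsq.ne_zero
  have : Finite X := Nat.finite_of_card_ne_zero hne
  have : Nonempty X := (Nat.card_ne_zero.mp hne).1
  refine ⟨fun q hq hdvd => ?_, fun i Q =>
    (S.prime_dvd_card_and_isPGroup hind hsq (hp i)).2 Q Q.isPGroup'⟩
  have h := (S.prime_dvd_card_and_isPGroup hind hsq hq).1 hdvd
  rw [hcard] at h
  obtain ⟨i, -, hi⟩ := hq.prime.exists_mem_finset_dvd h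
  exact ⟨i, ((Nat.prime_dvd_prime_iff_eq hq (hp i)).mp hi).symm⟩
end
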